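/- arXiv:1112.2992 — 7 statements merged into one kernel-verified Lean document; each statement's English description precedes it below -/
import Mathlib

section
/- Let Ψ : C⊗D → D⊗C be a twist map. The twisted coproduct Δ_Ψ := (id_C ⊗ Ψ ⊗ id_D) ∘ (Δ_C ⊗ Δ_D) is coassociative, i.e. (Δ_Ψ ⊗ id_{C⊗D}) ∘ Δ_Ψ = (id_{C⊗D} ⊗ Δ_Ψ) ∘ Δ_Ψ, if and only if Ψ satisfies condition (CO). -/
open TensorProduct LinearMap

noncomputable section
namespace TwistedTensor

/-- The coproduct of a coalgebra, with explicit arguments. -/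
def cmul (k C : Type*) [CommSemiring k] [AddCommMonoid C] [Module k C] [Coalgebra k C] :
    C →ₗ[k] C ⊗[k] C := Coalgebra.comul

/-- The counit of a coalgebra, with explicit arguments. -/
def eps (k C : Type*) [CommSemiring k] [AddCommMonoid C] [Module k C] [Coalgebra k C] :
    C →ₗ[k] k := Coalgebra.counit

variable {k : Type*} [Field k]
variable {C D : Type*} [AddCommGroup C] [Module k C] [AddCommGroup D] [Module k D]
  [Coalgebra k C] [Coalgebra k D]

/-- The twisted coproduct `Δ_Ψ := (id_C ⊗ Ψ ⊗ id_D) ∘ (Δ_C ⊗ Δ_D)` (with the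
appropriate reassociations of tensor factors). -/
def twistedComul (Ψ : C ⊗[k] D →ₗ[k] D ⊗[k] C) :
    C ⊗[k] D →ₗ[k] (C ⊗[k] D) ⊗[k] (C ⊗[k] D) :=
  (TensorProduct.assoc k C D (C ⊗[k] D)).symm.toLinearMap
    ∘ₗ lTensor C (TensorProduct.assoc k D C D).toLinearMap
    ∘ₗ lTensor C (rTensor D Ψ)
    ∘ₗ lTensor C (TensorProduct.assoc k C D D).symm.toLinearMap
    ∘ₗ (TensorProduct.assoc k C C (D ⊗[k] D)).toLinearMap
    ∘ₗ map (cmul k C) (cmul k D)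

/-- Left-hand side of condition (CO):
`(id_D⊗id_C⊗Ψ)∘(id_D⊗Δ_C⊗id_D)∘(Ψ⊗id_D)∘(id_C⊗Δ_D)`. -/
def COlhs (Ψ : C ⊗[k] D →ₗ[k] D ⊗[k] C) :
    C ⊗[k] D →ₗ[k] D ⊗[k] (C ⊗[k] (D ⊗[k] C)) :=
  lTensor D ((lTensor C Ψ) ∘ₗ (TensorProduct.assoc k C C D).toLinearMap)
    ∘ₗ lTensor D (rTensor D (cmul k C))
    ∘ₗ (TensorProduct.assoc k D C D).toLinearMap
    ∘ₗ rTensor D Ψ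
    ∘ₗ (TensorProduct.assoc k C D D).symm.toLinearMap
    ∘ₗ lTensor C (cmul k D)

/-- Right-hand side of condition (CO):
`(Ψ⊗id_D⊗id_C)∘(id_C⊗Δ_D⊗id_C)∘(id_C⊗Ψ)∘(Δ_C⊗id_D)`. -/
def COrhs (Ψ : C ⊗[k] D →ₗ[k] D ⊗[k] C) :
    C ⊗[k] D →ₗ[k] D ⊗[k] (C ⊗[k] (D ⊗[k] C)) :=
  (TensorProduct.assoc k D C (D ⊗[k] C)).toLinearMap
    ∘ₗ rTensor (D ⊗[k] C) Ψ
    ∘ₗ (TensorProduct.assoc k C D (D ⊗[k] C)).symm.toLinearMap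
    ∘ₗ lTensor C (TensorProduct.assoc k D D C).toLinearMap
    ∘ₗ lTensor C (rTensor C (cmul k D))
    ∘ₗ lTensor C Ψ
    ∘ₗ (TensorProduct.assoc k C C D).toLinearMap
    ∘ₗ rTensor D (cmul k C)

/-- Condition (CO) on a twist map. -/
def CondCO (Ψ : C ⊗[k] D →ₗ[k] D ⊗[k] C) : Prop := COlhs Ψ = COrhs Ψ

/-- The tensor counit `ε_⊗ = ε_C ⊗ ε_D`. -/
def tensorCounit : C ⊗[k] D →ₗ[k] k :=
  (TensorProduct.lid k k).toLinearMap ∘ₗ map (eps k C) (eps k D)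

/-- `e` is a counit for the coproduct `δ` on `C ⊗ D`. -/
def IsCounit (δ : C ⊗[k] D →ₗ[k] (C ⊗[k] D) ⊗[k] (C ⊗[k] D))
    (e : C ⊗[k] D →ₗ[k] k) : Prop :=
  (TensorProduct.lid k (C ⊗[k] D)).toLinearMap ∘ₗ rTensor (C ⊗[k] D) e ∘ₗ δ = LinearMap.id ∧
  (TensorProduct.rid k (C ⊗[k] D)).toLinearMap ∘ₗ lTensor (C ⊗[k] D) e ∘ₗ δ = LinearMap.id

/-- Right conormality: `(ε_D⊗id_C)∘Ψ = id_C⊗ε_D`. -/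
def RightConormal (Ψ : C ⊗[k] D →ₗ[k] D ⊗[k] C) : Prop :=
  (TensorProduct.lid k C).toLinearMap ∘ₗ rTensor C (eps k D) ∘ₗ Ψ
    = (TensorProduct.rid k C).toLinearMap ∘ₗ lTensor C (eps k D)

/-- Left conormality: `(id_D⊗ε_C)∘Ψ = ε_C⊗id_D`. -/
def LeftConormal (Ψ : C ⊗[k] D →ₗ[k] D ⊗[k] C) : Prop :=
  (TensorProduct.rid k D).toLinearMap ∘ₗ lTensor D (eps k C) ∘ₗ Ψ
    = (TensorProduct.lid k D).toLinearMap ∘ₗ rTensor D (eps k C)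

/-- Conormality of a twist map. -/
def Conormal (Ψ : C ⊗[k] D →ₗ[k] D ⊗[k] C) : Prop :=
  RightConormal Ψ ∧ LeftConormal Ψ

/-- Condition (CP1): `(id_D⊗Ψ)∘(Ψ⊗id_D)∘(id_C⊗Δ_D) = (Δ_D⊗id_C)∘Ψ`. -/
def CP1 (Ψ : C ⊗[k] D →ₗ[k] D ⊗[k] C) : Prop :=
  lTensor D Ψ ∘ₗ (TensorProduct.assoc k D C D).toLinearMap ∘ₗ rTensor D Ψ
      ∘ₗ (TensorProduct.assoc k C D D).symm.toLinearMap ∘ₗ lTensor C (cmul k D)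
    = (TensorProduct.assoc k D D C).toLinearMap ∘ₗ rTensor C (cmul k D) ∘ₗ Ψ

/-- Condition (CP2): `(Ψ⊗id_C)∘(id_C⊗Ψ)∘(Δ_C⊗id_D) = (id_D⊗Δ_C)∘Ψ`. -/
def CP2 (Ψ : C ⊗[k] D →ₗ[k] D ⊗[k] C) : Prop :=
  (TensorProduct.assoc k D C C).toLinearMap ∘ₗ rTensor C Ψ
      ∘ₗ (TensorProduct.assoc k C D C).symm.toLinearMap ∘ₗ lTensor C Ψ
      ∘ₗ (TensorProduct.assoc k C C D).toLinearMap ∘ₗ rTensor D (cmul k C)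
    = lTensor D (cmul k C) ∘ₗ Ψ

/-- The functional `ε_Z := (ε_D⊗ε_C)∘Z`. -/
def epsZ (Z : C ⊗[k] D →ₗ[k] D ⊗[k] C) : C ⊗[k] D →ₗ[k] k :=
  (TensorProduct.lid k k).toLinearMap ∘ₗ map (eps k D) (eps k C) ∘ₗ Z

/-- Right `Z`-conormality: `(ε_Z⊗id_C)∘(id_C⊗Ψ)∘(Δ_C⊗id_D) = id_C⊗ε_D`. -/
def RightZConormal (Ψ Z : C ⊗[k] D →ₗ[k] D ⊗[k] C) : Prop :=
  (TensorProduct.lid k C).toLinearMap ∘ₗ rTensor C (epsZ Z)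
      ∘ₗ (TensorProduct.assoc k C D C).symm.toLinearMap ∘ₗ lTensor C Ψ
      ∘ₗ (TensorProduct.assoc k C C D).toLinearMap ∘ₗ rTensor D (cmul k C)
    = (TensorProduct.rid k C).toLinearMap ∘ₗ lTensor C (eps k D)

/-- Left `Z`-conormality: `(id_D⊗ε_Z)∘(Ψ⊗id_D)∘(id_C⊗Δ_D) = ε_C⊗id_D`. -/
def LeftZConormal (Ψ Z : C ⊗[k] D →ₗ[k] D ⊗[k] C) : Prop :=
  (TensorProduct.rid k D).toLinearMap ∘ₗ lTensor D (epsZ Z)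
      ∘ₗ (TensorProduct.assoc k D C D).toLinearMap ∘ₗ rTensor D Ψ
      ∘ₗ (TensorProduct.assoc k C D D).symm.toLinearMap ∘ₗ lTensor C (cmul k D)
    = (TensorProduct.lid k D).toLinearMap ∘ₗ rTensor D (eps k C)

/-- `Z`-conormality. -/
def ZConormal (Ψ Z : C ⊗[k] D →ₗ[k] D ⊗[k] C) : Prop :=
  RightZConormal Ψ Z ∧ LeftZConormal Ψ Z

/-- The projection `p_C := (id_C⊗e)∘(Δ_C⊗id_D)`. -/
def pC (e : C ⊗[k] D →ₗ[k] k) : C ⊗[k] D →ₗ[k] C :=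
  (TensorProduct.rid k C).toLinearMap ∘ₗ lTensor C e
    ∘ₗ (TensorProduct.assoc k C C D).toLinearMap ∘ₗ rTensor D (cmul k C)

/-- The projection `p_D := (e⊗id_D)∘(id_C⊗Δ_D)`. -/
def pD (e : C ⊗[k] D →ₗ[k] k) : C ⊗[k] D →ₗ[k] D :=
  (TensorProduct.lid k D).toLinearMap ∘ₗ rTensor D e
    ∘ₗ (TensorProduct.assoc k C D D).symm.toLinearMap ∘ₗ lTensor C (cmul k D)

/-- The projection `π_C = id_C ⊗ ε_D`. -/
def piC : C ⊗[k] D →ₗ[k] C :=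
  (TensorProduct.rid k C).toLinearMap ∘ₗ lTensor C (eps k D)

/-- The projection `π_D = ε_C ⊗ id_D`. -/
def piD : C ⊗[k] D →ₗ[k] D :=
  (TensorProduct.lid k D).toLinearMap ∘ₗ rTensor D (eps k C)

/-- Convolution product on `(C⊗D)'`: `(φ∗φ')(c⊗d) = φ(c₁⊗d₁)φ'(c₂⊗d₂)`. -/
def convMul (φ φ' : C ⊗[k] D →ₗ[k] k) : C ⊗[k] D →ₗ[k] k :=
  (TensorProduct.lid k k).toLinearMap ∘ₗ map φ φ'
    ∘ₗ (tensorTensorTensorComm k C C D D).toLinearMap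
    ∘ₗ map (cmul k C) (cmul k D)

/-- `⋆`-product on `(C⊗D)'`: `(φ⋆φ')(c⊗d) = φ(c₂⊗d₁)φ'(c₁⊗d₂)`. -/
def starMul (φ φ' : C ⊗[k] D →ₗ[k] k) : C ⊗[k] D →ₗ[k] k :=
  (TensorProduct.lid k k).toLinearMap ∘ₗ map φ φ'
    ∘ₗ (tensorTensorTensorComm k C C D D).toLinearMap
    ∘ₗ rTensor (D ⊗[k] D) (TensorProduct.comm k C C).toLinearMap
    ∘ₗ map (cmul k C) (cmul k D)

/-- Condition (LC1): `(Δ_D⊗id_C)∘Ψ' = (id_D⊗Ψ')∘(Δ_D⊗id_C)`. -/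
def LC1 (Ψ' : D ⊗[k] C →ₗ[k] D ⊗[k] C) : Prop :=
  (TensorProduct.assoc k D D C).toLinearMap ∘ₗ rTensor C (cmul k D) ∘ₗ Ψ'
    = lTensor D Ψ' ∘ₗ (TensorProduct.assoc k D D C).toLinearMap ∘ₗ rTensor C (cmul k D)

/-- Condition (LC2): `(id_D⊗Δ_C)∘Ψ' = (Ψ'⊗id_C)∘(id_D⊗Δ_C)`. -/
def LC2 (Ψ' : D ⊗[k] C →ₗ[k] D ⊗[k] C) : Prop :=
  lTensor D (cmul k C) ∘ₗ Ψ'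
    = (TensorProduct.assoc k D C C).toLinearMap ∘ₗ rTensor C Ψ'
        ∘ₗ (TensorProduct.assoc k D C C).symm.toLinearMap ∘ₗ lTensor D (cmul k C)

/-- `Ψ' := Ψ ∘ τ`. -/
def psiPrime (Ψ : C ⊗[k] D →ₗ[k] D ⊗[k] C) : D ⊗[k] C →ₗ[k] D ⊗[k] C :=
  Ψ ∘ₗ (TensorProduct.comm k D C).toLinearMap

/-- The twist `Ψ'_φ : d⊗c ↦ φ(c₁⊗d₂) d₁⊗c₂` associated to a functional `φ`. -/
def PsiPhi (φ : C ⊗[k] D →ₗ[k] k) : D ⊗[k] C →ₗ[k] D ⊗[k] C :=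
  (TensorProduct.rid k (D ⊗[k] C)).toLinearMap
    ∘ₗ lTensor (D ⊗[k] C) φ
    ∘ₗ lTensor (D ⊗[k] C) (TensorProduct.comm k D C).toLinearMap
    ∘ₗ (tensorTensorTensorComm k D D C C).toLinearMap
    ∘ₗ lTensor (D ⊗[k] D) (TensorProduct.comm k C C).toLinearMap
    ∘ₗ map (cmul k D) (cmul k C)

/-- The functional `F(Ψ') := (ε_D⊗ε_C)∘Ψ'∘τ` associated to a twist `Ψ' : D⊗C → D⊗C`. -/
def Ffun (Ψ' : D ⊗[k] C →ₗ[k] D ⊗[k] C) : C ⊗[k] D →ₗ[k] k :=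
  (TensorProduct.lid k k).toLinearMap ∘ₗ map (eps k D) (eps k C) ∘ₗ Ψ'
    ∘ₗ (TensorProduct.comm k C D).toLinearMap

/-- The tensor product coproduct `Δ_⊗` on `C ⊗ D`. -/
def tensorComul : C ⊗[k] D →ₗ[k] (C ⊗[k] D) ⊗[k] (C ⊗[k] D) :=
  (tensorTensorTensorComm k C C D D).toLinearMap ∘ₗ map (cmul k C) (cmul k D)

/-- The map `id_C ⊗ Ψ' ⊗ id_D : (C⊗D)⊗(C⊗D) → (C⊗D)⊗(C⊗D)`. -/
def midMap (Ψ' : D ⊗[k] C →ₗ[k] D ⊗[k] C) :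
    (C ⊗[k] D) ⊗[k] (C ⊗[k] D) →ₗ[k] (C ⊗[k] D) ⊗[k] (C ⊗[k] D) :=
  (TensorProduct.assoc k C D (C ⊗[k] D)).symm.toLinearMap
    ∘ₗ lTensor C ((TensorProduct.assoc k D C D).toLinearMap ∘ₗ rTensor D Ψ'
        ∘ₗ (TensorProduct.assoc k D C D).symm.toLinearMap)
    ∘ₗ (TensorProduct.assoc k C D (C ⊗[k] D)).toLinearMap

/-- `C` is co-commutative up to isomorphism: there is a coalgebra isomorphism `C ≅ C^cop`. -/
def CocommUpToIso (k C : Type*) [CommSemiring k] [AddCommMonoid C] [Module k C]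
    [Coalgebra k C] : Prop :=
  ∃ χ : C →ₗ[k] C, Function.Bijective χ ∧
    map χ χ ∘ₗ cmul k C = (TensorProduct.comm k C C).toLinearMap ∘ₗ cmul k C ∘ₗ χ ∧
    eps k C ∘ₗ χ = eps k C

/-- The map `c ⊗ d ↦ c₁ ⊗ f (c₂ ⊗ d₁) ⊗ d₂`. -/
def sandwich {X : Type*} [AddCommGroup X] [Module k X] (f : C ⊗[k] D →ₗ[k] X) :
    C ⊗[k] D →ₗ[k] C ⊗[k] (X ⊗[k] D) :=
  lTensor C (rTensor D f)
    ∘ₗ lTensor C (TensorProduct.assoc k C D D).symm.toLinearMap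
    ∘ₗ (TensorProduct.assoc k C C (D ⊗[k] D)).toLinearMap
    ∘ₗ map (cmul k C) (cmul k D)

/-- Applying the counits to the outer factors of `C ⊗ (X ⊗ D)`. -/
def outerCounit (k C D X : Type*) [Field k] [AddCommGroup C] [Module k C]
    [AddCommGroup D] [Module k D] [Coalgebra k C] [Coalgebra k D]
    [AddCommGroup X] [Module k X] : C ⊗[k] (X ⊗[k] D) →ₗ[k] X :=
  (TensorProduct.lid k X).toLinearMap
    ∘ₗ map (eps k C) ((TensorProduct.rid k X).toLinearMap ∘ₗ lTensor X (eps k D))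

theorem outerCounit_comp_sandwich {X : Type*} [AddCommGroup X] [Module k X]
    (f : C ⊗[k] D →ₗ[k] X) : outerCounit k C D X ∘ₗ sandwich f = f := by
  have key : ∀ (x : C ⊗[k] C) (y : D ⊗[k] D),
      outerCounit k C D X (lTensor C (rTensor D f)
        (lTensor C (TensorProduct.assoc k C D D).symm.toLinearMap
          (TensorProduct.assoc k C C (D ⊗[k] D) (x ⊗ₜ y))))
      = f (TensorProduct.lid k C (rTensor C (eps k C) x) ⊗ₜ
          TensorProduct.rid k D (lTensor D (eps k D) y)) := by
    intro x y
    induction x with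
    | zero => simp
    | add _ _ h₁ h₂ => simp only [map_add, add_tmul, h₁, h₂]
    | tmul a b =>
      induction y with
      | zero => simp
      | add _ _ h₁ h₂ => simp only [map_add, tmul_add, h₁, h₂]
      | tmul e g => simp [outerCounit, tmul_smul, ← smul_tmul']
  ext c d
  simpa [sandwich, cmul, eps] using key (cmul k C c) (cmul k D d)

theorem sandwich_injective {X : Type*} [AddCommGroup X] [Module k X] :
    Function.Injective (sandwich : (C ⊗[k] D →ₗ[k] X) → _) := by
  intro f g h
  rw [← outerCounit_comp_sandwich f, h, outerCounit_comp_sandwich]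

/-- The reassociation `(C ⊗ D) ⊗ ((C ⊗ D) ⊗ (C ⊗ D)) ≃ C ⊗ ((D ⊗ (C ⊗ (D ⊗ C))) ⊗ D)`. -/
def regroup (k C D : Type*) [Field k] [AddCommGroup C] [Module k C]
    [AddCommGroup D] [Module k D] :
    (C ⊗[k] D) ⊗[k] ((C ⊗[k] D) ⊗[k] (C ⊗[k] D)) ≃ₗ[k]
      C ⊗[k] ((D ⊗[k] (C ⊗[k] (D ⊗[k] C))) ⊗[k] D) :=
  TensorProduct.assoc k C D _ ≪≫ₗ
    LinearEquiv.lTensor C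
      (LinearEquiv.lTensor D
        (TensorProduct.assoc k C D (C ⊗[k] D) ≪≫ₗ
          LinearEquiv.lTensor C (TensorProduct.assoc k D C D).symm ≪≫ₗ
          (TensorProduct.assoc k C (D ⊗[k] C) D).symm) ≪≫ₗ
        (TensorProduct.assoc k D (C ⊗[k] (D ⊗[k] C)) D).symm)

set_option linter.unusedSectionVars false in
@[simp]
theorem regroup_tmul (a c e : C) (b d f : D) :
    regroup k C D ((a ⊗ₜ b) ⊗ₜ ((c ⊗ₜ d) ⊗ₜ (e ⊗ₜ f)))
      = a ⊗ₜ ((b ⊗ₜ (c ⊗ₜ (d ⊗ₜ e))) ⊗ₜ f) := by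
  simp [regroup]

/-- The reassociation `C ⊗ ((D ⊗ C) ⊗ D) ≃ (C ⊗ D) ⊗ (C ⊗ D)`. -/
def splitMid (k C D : Type*) [Field k] [AddCommGroup C] [Module k C]
    [AddCommGroup D] [Module k D] :
    C ⊗[k] ((D ⊗[k] C) ⊗[k] D) ≃ₗ[k] (C ⊗[k] D) ⊗[k] (C ⊗[k] D) :=
  LinearEquiv.lTensor C (TensorProduct.assoc k D C D) ≪≫ₗ
    (TensorProduct.assoc k C D (C ⊗[k] D)).symm

set_option linter.unusedSectionVars false in
@[simp]
theorem splitMid_tmul (a b : C) (d e : D) :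
    splitMid k C D (a ⊗ₜ ((d ⊗ₜ b) ⊗ₜ e)) = (a ⊗ₜ d) ⊗ₜ (b ⊗ₜ e) := by
  simp [splitMid]

theorem twistedComul_eq_splitMid_sandwich (Ψ : C ⊗[k] D →ₗ[k] D ⊗[k] C) :
    twistedComul Ψ = (splitMid k C D).toLinearMap ∘ₗ sandwich Ψ := rfl

/-- The map `(Ψ ⊗ id_D ⊗ id_C) ∘ (id_C ⊗ Δ_D ⊗ id_C)`. -/
def rightCore (Ψ : C ⊗[k] D →ₗ[k] D ⊗[k] C) :
    C ⊗[k] (D ⊗[k] C) →ₗ[k] D ⊗[k] (C ⊗[k] (D ⊗[k] C)) :=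
  (TensorProduct.assoc k D C (D ⊗[k] C)).toLinearMap
    ∘ₗ rTensor (D ⊗[k] C) Ψ
    ∘ₗ (TensorProduct.assoc k C D (D ⊗[k] C)).symm.toLinearMap
    ∘ₗ lTensor C (TensorProduct.assoc k D D C).toLinearMap
    ∘ₗ lTensor C (rTensor C (cmul k D))

/-- The map `(id_D ⊗ id_C ⊗ Ψ) ∘ (id_D ⊗ Δ_C ⊗ id_D)`. -/
def leftCore (Ψ : C ⊗[k] D →ₗ[k] D ⊗[k] C) :
    (D ⊗[k] C) ⊗[k] D →ₗ[k] D ⊗[k] (C ⊗[k] (D ⊗[k] C)) :=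
  lTensor D ((lTensor C Ψ) ∘ₗ (TensorProduct.assoc k C C D).toLinearMap)
    ∘ₗ lTensor D (rTensor D (cmul k C))
    ∘ₗ (TensorProduct.assoc k D C D).toLinearMap

/-- The map `u ⊗ v ⊗ t ⊗ f ↦ u ⊗ rightCore Ψ (v ⊗ t) ⊗ f`. -/
def rightSpread (Ψ : C ⊗[k] D →ₗ[k] D ⊗[k] C) :
    (C ⊗[k] C) ⊗[k] ((D ⊗[k] C) ⊗[k] D) →ₗ[k]
      C ⊗[k] ((D ⊗[k] (C ⊗[k] (D ⊗[k] C))) ⊗[k] D) :=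
  lTensor C (rTensor D (rightCore Ψ)
      ∘ₗ (TensorProduct.assoc k C (D ⊗[k] C) D).symm.toLinearMap)
    ∘ₗ (TensorProduct.assoc k C C ((D ⊗[k] C) ⊗[k] D)).toLinearMap

set_option linter.unusedSectionVars false in
@[simp]
theorem rightSpread_tmul (Ψ : C ⊗[k] D →ₗ[k] D ⊗[k] C) (u v : C) (t : D ⊗[k] C) (f : D) :
    rightSpread Ψ ((u ⊗ₜ v) ⊗ₜ (t ⊗ₜ f)) = u ⊗ₜ (rightCore Ψ (v ⊗ₜ t) ⊗ₜ f) := by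
  simp [rightSpread]

/-- The map `a ⊗ t ⊗ r ⊗ s ↦ a ⊗ leftCore Ψ (t ⊗ r) ⊗ s`. -/
def leftSpread (Ψ : C ⊗[k] D →ₗ[k] D ⊗[k] C) :
    C ⊗[k] ((D ⊗[k] C) ⊗[k] (D ⊗[k] D)) →ₗ[k]
      C ⊗[k] ((D ⊗[k] (C ⊗[k] (D ⊗[k] C))) ⊗[k] D) :=
  lTensor C (rTensor D (leftCore Ψ)
      ∘ₗ (TensorProduct.assoc k (D ⊗[k] C) D D).symm.toLinearMap)

set_option linter.unusedSectionVars false in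
@[simp]
theorem leftSpread_tmul (Ψ : C ⊗[k] D →ₗ[k] D ⊗[k] C) (a : C) (t : D ⊗[k] C) (r s : D) :
    leftSpread Ψ (a ⊗ₜ (t ⊗ₜ (r ⊗ₜ s))) = a ⊗ₜ (leftCore Ψ (t ⊗ₜ r) ⊗ₜ s) := by
  simp [leftSpread]

theorem regroup_rTensor_splitMid (Ψ : C ⊗[k] D →ₗ[k] D ⊗[k] C) (a : C) (t : D ⊗[k] C) (f : D) :
    regroup k C D (TensorProduct.assoc k (C ⊗[k] D) (C ⊗[k] D) (C ⊗[k] D)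
        (rTensor (C ⊗[k] D) (twistedComul Ψ) (splitMid k C D (a ⊗ₜ (t ⊗ₜ f)))))
      = rightSpread Ψ (cmul k C a ⊗ₜ (t ⊗ₜ f)) := by
  induction t with
  | zero => simp
  | add _ _ h₁ h₂ => simp only [map_add, add_tmul, tmul_add, h₁, h₂]
  | tmul p q =>
    simp only [splitMid_tmul, rTensor_tmul, twistedComul_eq_splitMid_sandwich, sandwich,
      coe_comp, Function.comp_apply, LinearEquiv.coe_coe, map_tmul]
    induction cmul k C a with
    | zero => simp
    | add _ _ h₁ h₂ => simp only [map_add, add_tmul, h₁, h₂]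
    | tmul u v =>
      simp only [rightSpread_tmul, rightCore, coe_comp, Function.comp_apply,
        LinearEquiv.coe_coe, lTensor_tmul, rTensor_tmul, TensorProduct.assoc_tmul]
      induction cmul k D p with
      | zero => simp
      | add _ _ h₁ h₂ => simp only [map_add, add_tmul, tmul_add, h₁, h₂]
      | tmul r s =>
        simp only [TensorProduct.assoc_symm_tmul, TensorProduct.assoc_tmul, rTensor_tmul]
        induction Ψ (v ⊗ₜ r) with
        | zero => simp
        | add _ _ h₁ h₂ => simp only [map_add, add_tmul, tmul_add, h₁, h₂]
        | tmul w z => simp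

theorem regroup_lTensor_splitMid (Ψ : C ⊗[k] D →ₗ[k] D ⊗[k] C) (a : C) (t : D ⊗[k] C) (f : D) :
    regroup k C D (lTensor (C ⊗[k] D) (twistedComul Ψ) (splitMid k C D (a ⊗ₜ (t ⊗ₜ f))))
      = leftSpread Ψ (a ⊗ₜ (t ⊗ₜ cmul k D f)) := by
  induction t with
  | zero => simp
  | add _ _ h₁ h₂ => simp only [map_add, add_tmul, tmul_add, h₁, h₂]
  | tmul p q =>
    simp only [splitMid_tmul, lTensor_tmul, twistedComul_eq_splitMid_sandwich, sandwich,
      coe_comp, Function.comp_apply, LinearEquiv.coe_coe, map_tmul]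
    induction cmul k D f with
    | zero => simp
    | add _ _ h₁ h₂ => simp only [map_add, tmul_add, h₁, h₂]
    | tmul r s =>
      simp only [leftSpread_tmul, leftCore, coe_comp, Function.comp_apply,
        LinearEquiv.coe_coe, lTensor_tmul, rTensor_tmul, TensorProduct.assoc_tmul]
      induction cmul k C q with
      | zero => simp
      | add _ _ h₁ h₂ => simp only [map_add, add_tmul, tmul_add, h₁, h₂]
      | tmul u v =>
        simp only [TensorProduct.assoc_symm_tmul, TensorProduct.assoc_tmul, rTensor_tmul,
          lTensor_tmul, LinearEquiv.coe_coe]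
        induction Ψ (v ⊗ₜ r) with
        | zero => simp
        | add _ _ h₁ h₂ => simp only [map_add, add_tmul, tmul_add, h₁, h₂]
        | tmul w z => simp

/-- The map `u ⊗ v ⊗ b ⊗ e ⊗ f ↦ u ⊗ rightCore Ψ (v ⊗ Ψ (b ⊗ e)) ⊗ f`. -/
def rightTotal (Ψ : C ⊗[k] D →ₗ[k] D ⊗[k] C) :
    (C ⊗[k] (C ⊗[k] C)) ⊗[k] (D ⊗[k] D) →ₗ[k]
      C ⊗[k] ((D ⊗[k] (C ⊗[k] (D ⊗[k] C))) ⊗[k] D) :=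
  lTensor C (rTensor D (rightCore Ψ ∘ₗ lTensor C Ψ ∘ₗ (TensorProduct.assoc k C C D).toLinearMap)
      ∘ₗ (TensorProduct.assoc k (C ⊗[k] C) D D).symm.toLinearMap)
    ∘ₗ (TensorProduct.assoc k C (C ⊗[k] C) (D ⊗[k] D)).toLinearMap

/-- The map `a ⊗ b ⊗ e ⊗ r ⊗ s ↦ a ⊗ leftCore Ψ (Ψ (b ⊗ e) ⊗ r) ⊗ s`. -/
def leftTotal (Ψ : C ⊗[k] D →ₗ[k] D ⊗[k] C) :
    (C ⊗[k] C) ⊗[k] (D ⊗[k] (D ⊗[k] D)) →ₗ[k]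
      C ⊗[k] ((D ⊗[k] (C ⊗[k] (D ⊗[k] C))) ⊗[k] D) :=
  leftSpread Ψ
    ∘ₗ lTensor C (rTensor (D ⊗[k] D) Ψ
      ∘ₗ (TensorProduct.assoc k C D (D ⊗[k] D)).symm.toLinearMap)
    ∘ₗ (TensorProduct.assoc k C C (D ⊗[k] (D ⊗[k] D))).toLinearMap

theorem sandwich_COrhs_tmul (Ψ : C ⊗[k] D →ₗ[k] D ⊗[k] C) (c : C) (d : D) :
    sandwich (COrhs Ψ) (c ⊗ₜ d)
      = rightTotal Ψ (lTensor C (cmul k C) (cmul k C c) ⊗ₜ cmul k D d) := by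
  simp only [sandwich, coe_comp, Function.comp_apply, map_tmul, LinearEquiv.coe_coe]
  induction cmul k C c with
  | zero => simp
  | add _ _ h₁ h₂ => simp only [map_add, add_tmul, h₁, h₂]
  | tmul a b =>
    induction cmul k D d with
    | zero => simp
    | add _ _ h₁ h₂ => simp only [map_add, tmul_add, h₁, h₂]
    | tmul e f => simp [rightTotal, COrhs, rightCore]

theorem sandwich_COlhs_tmul (Ψ : C ⊗[k] D →ₗ[k] D ⊗[k] C) (c : C) (d : D) :
    sandwich (COlhs Ψ) (c ⊗ₜ d)
      = leftTotal Ψ (cmul k C c ⊗ₜ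
          TensorProduct.assoc k D D D (rTensor D (cmul k D) (cmul k D d))) := by
  simp only [sandwich, coe_comp, Function.comp_apply, map_tmul, LinearEquiv.coe_coe]
  induction cmul k C c with
  | zero => simp
  | add _ _ h₁ h₂ => simp only [map_add, add_tmul, h₁, h₂]
  | tmul a b =>
    induction cmul k D d with
    | zero => simp
    | add _ _ h₁ h₂ => simp only [map_add, tmul_add, h₁, h₂]
    | tmul e f =>
      simp only [TensorProduct.assoc_tmul, lTensor_tmul, rTensor_tmul, LinearEquiv.coe_coe,
        TensorProduct.assoc_symm_tmul, COlhs, coe_comp, Function.comp_apply, leftTotal]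
      induction cmul k D e with
      | zero => simp
      | add _ _ h₁ h₂ => simp only [map_add, add_tmul, tmul_add, h₁, h₂]
      | tmul r s => simp [leftCore]

theorem regroup_comul_left (Ψ : C ⊗[k] D →ₗ[k] D ⊗[k] C) :
    (regroup k C D).toLinearMap
      ∘ₗ (TensorProduct.assoc k (C ⊗[k] D) (C ⊗[k] D) (C ⊗[k] D)).toLinearMap
      ∘ₗ rTensor (C ⊗[k] D) (twistedComul Ψ) ∘ₗ twistedComul Ψ
      = sandwich (COrhs Ψ) := by
  refine TensorProduct.ext' fun c d => ?_
  have hc : lTensor C (cmul k C) (cmul k C c)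
      = TensorProduct.assoc k C C C (rTensor C (cmul k C) (cmul k C c)) :=
    (Coalgebra.coassoc_apply c).symm
  rw [sandwich_COrhs_tmul, hc]
  simp only [coe_comp, Function.comp_apply, LinearEquiv.coe_coe]
  rw [show twistedComul Ψ (c ⊗ₜ d) = splitMid k C D (sandwich Ψ (c ⊗ₜ d)) from rfl]
  simp only [sandwich, coe_comp, Function.comp_apply, map_tmul, LinearEquiv.coe_coe]
  induction cmul k C c with
  | zero => simp
  | add _ _ h₁ h₂ => simp only [map_add, add_tmul, h₁, h₂]
  | tmul a b =>
    induction cmul k D d with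
    | zero => simp
    | add _ _ h₁ h₂ => simp only [map_add, tmul_add, h₁, h₂]
    | tmul e f =>
      simp only [TensorProduct.assoc_tmul, lTensor_tmul, rTensor_tmul, LinearEquiv.coe_coe,
        TensorProduct.assoc_symm_tmul, regroup_rTensor_splitMid]
      induction cmul k C a with
      | zero => simp
      | add _ _ h₁ h₂ => simp only [map_add, add_tmul, h₁, h₂]
      | tmul u v => simp [rightTotal]

theorem regroup_comul_right (Ψ : C ⊗[k] D →ₗ[k] D ⊗[k] C) :
    (regroup k C D).toLinearMap ∘ₗ lTensor (C ⊗[k] D) (twistedComul Ψ) ∘ₗ twistedComul Ψ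
      = sandwich (COlhs Ψ) := by
  refine TensorProduct.ext' fun c d => ?_
  have hd : TensorProduct.assoc k D D D (rTensor D (cmul k D) (cmul k D d))
      = lTensor D (cmul k D) (cmul k D d) :=
    Coalgebra.coassoc_apply d
  rw [sandwich_COlhs_tmul, hd]
  simp only [coe_comp, Function.comp_apply, LinearEquiv.coe_coe]
  rw [show twistedComul Ψ (c ⊗ₜ d) = splitMid k C D (sandwich Ψ (c ⊗ₜ d)) from rfl]
  simp only [sandwich, coe_comp, Function.comp_apply, map_tmul, LinearEquiv.coe_coe]
  induction cmul k C c with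
  | zero => simp
  | add _ _ h₁ h₂ => simp only [map_add, add_tmul, h₁, h₂]
  | tmul a b =>
    induction cmul k D d with
    | zero => simp
    | add _ _ h₁ h₂ => simp only [map_add, tmul_add, h₁, h₂]
    | tmul e f =>
      simp only [TensorProduct.assoc_tmul, lTensor_tmul, rTensor_tmul, LinearEquiv.coe_coe,
        TensorProduct.assoc_symm_tmul, regroup_lTensor_splitMid, leftTotal, coe_comp,
        Function.comp_apply]

theorem stmt0 (Ψ : C ⊗[k] D →ₗ[k] D ⊗[k] C) :
    ((TensorProduct.assoc k (C ⊗[k] D) (C ⊗[k] D) (C ⊗[k] D)).toLinearMap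
        ∘ₗ rTensor (C ⊗[k] D) (twistedComul Ψ) ∘ₗ twistedComul Ψ
      = lTensor (C ⊗[k] D) (twistedComul Ψ) ∘ₗ twistedComul Ψ)
    ↔ CondCO Ψ := by
  have h : COlhs Ψ = COrhs Ψ ↔ sandwich (COrhs Ψ) = sandwich (COlhs Ψ) :=
    eq_comm.trans sandwich_injective.eq_iff.symm
  rw [CondCO, h, ← regroup_comul_left, ← regroup_comul_right]
  exact (LinearMap.cancel_left (regroup k C D).injective).symm

end TwistedTensor
end
end

section
/- Let Ψ : C⊗D → D⊗C be a twist map. The tensor counit ε_⊗ := ε_C⊗ε_D is a counit for the twisted coproduct Δ_Ψ, i.e. (ε_⊗ ⊗ id_{C⊗D}) ∘ Δ_Ψ = id_{C⊗D} = (id_{C⊗D} ⊗ ε_⊗) ∘ Δ_Ψ, if and only if Ψ is conormal. -/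
open TensorProduct LinearMap

noncomputable section
namespace TwistedTensor

variable {k : Type*} [Field k]
variable {C D : Type*} [AddCommGroup C] [Module k C] [AddCommGroup D] [Module k D]
  [Coalgebra k C] [Coalgebra k D]

/-- The map `(ε_D ⊗ id_C) ∘ Ψ`. -/
def rightPart (Ψ : C ⊗[k] D →ₗ[k] D ⊗[k] C) : C ⊗[k] D →ₗ[k] C :=
  (TensorProduct.lid k C).toLinearMap ∘ₗ rTensor C (eps k D) ∘ₗ Ψ

/-- The map `(id_D ⊗ ε_C) ∘ Ψ`. -/
def leftPart (Ψ : C ⊗[k] D →ₗ[k] D ⊗[k] C) : C ⊗[k] D →ₗ[k] D :=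
  (TensorProduct.rid k D).toLinearMap ∘ₗ lTensor D (eps k C) ∘ₗ Ψ

theorem lid_comp_rTensor_eps_comp_cmul :
    (TensorProduct.lid k C).toLinearMap ∘ₗ rTensor C (eps k C) ∘ₗ cmul k C = LinearMap.id := by
  ext c
  simp [eps, cmul]

theorem rid_comp_lTensor_eps_comp_cmul :
    (TensorProduct.rid k C).toLinearMap ∘ₗ lTensor C (eps k C) ∘ₗ cmul k C = LinearMap.id := by
  ext c
  simp [eps, cmul]

theorem lid_comp_rTensor_tensorCounit_comp_twistedComul (Ψ : C ⊗[k] D →ₗ[k] D ⊗[k] C) :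
    (TensorProduct.lid k (C ⊗[k] D)).toLinearMap ∘ₗ rTensor (C ⊗[k] D) tensorCounit
        ∘ₗ twistedComul Ψ
      = rTensor D (rightPart Ψ) ∘ₗ (TensorProduct.assoc k C D D).symm.toLinearMap
        ∘ₗ lTensor C (cmul k D) := by
  have middle :
      (TensorProduct.lid k (C ⊗[k] D)).toLinearMap ∘ₗ rTensor (C ⊗[k] D) tensorCounit
        ∘ₗ (TensorProduct.assoc k C D (C ⊗[k] D)).symm.toLinearMap
        ∘ₗ lTensor C (TensorProduct.assoc k D C D).toLinearMap
        ∘ₗ lTensor C (rTensor D Ψ)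
        ∘ₗ lTensor C (TensorProduct.assoc k C D D).symm.toLinearMap
        ∘ₗ (TensorProduct.assoc k C C (D ⊗[k] D)).toLinearMap
      = rTensor D (rightPart Ψ) ∘ₗ (TensorProduct.assoc k C D D).symm.toLinearMap
        ∘ₗ rTensor (D ⊗[k] D)
          ((TensorProduct.lid k C).toLinearMap ∘ₗ rTensor C (eps k C)) := by
    ext a b x y
    simp only [rightPart, AlgebraTensorModule.curry_apply, curry_apply, coe_restrictScalars,
      coe_comp, LinearEquiv.coe_coe, Function.comp_apply, assoc_tmul, lTensor_tmul,
      assoc_symm_tmul, rTensor_tmul, lid_tmul, ← smul_tmul', map_smul]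
    induction Ψ (b ⊗ₜ[k] x) with
    | zero => simp
    | add u v hu hv => simp only [add_tmul, tmul_add, map_add, smul_add, hu, hv]
    | tmul u v => simp [tensorCounit, smul_tmul', mul_smul]
  have h := congrArg (· ∘ₗ map (cmul k C) (cmul k D)) middle
  refine Eq.trans ?_ (h.trans ?_)
  · rfl
  · simp only [comp_assoc, rTensor_comp_map, lid_comp_rTensor_eps_comp_cmul]
    rfl

theorem rid_comp_lTensor_tensorCounit_comp_twistedComul (Ψ : C ⊗[k] D →ₗ[k] D ⊗[k] C) :
    (TensorProduct.rid k (C ⊗[k] D)).toLinearMap ∘ₗ lTensor (C ⊗[k] D) tensorCounit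
        ∘ₗ twistedComul Ψ
      = lTensor C (leftPart Ψ) ∘ₗ (TensorProduct.assoc k C C D).toLinearMap
        ∘ₗ rTensor D (cmul k C) := by
  have middle :
      (TensorProduct.rid k (C ⊗[k] D)).toLinearMap ∘ₗ lTensor (C ⊗[k] D) tensorCounit
        ∘ₗ (TensorProduct.assoc k C D (C ⊗[k] D)).symm.toLinearMap
        ∘ₗ lTensor C (TensorProduct.assoc k D C D).toLinearMap
        ∘ₗ lTensor C (rTensor D Ψ)
        ∘ₗ lTensor C (TensorProduct.assoc k C D D).symm.toLinearMap
        ∘ₗ (TensorProduct.assoc k C C (D ⊗[k] D)).toLinearMap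
      = lTensor C (leftPart Ψ) ∘ₗ (TensorProduct.assoc k C C D).toLinearMap
        ∘ₗ lTensor (C ⊗[k] C)
          ((TensorProduct.rid k D).toLinearMap ∘ₗ lTensor D (eps k D)) := by
    ext a b x y
    simp only [leftPart, AlgebraTensorModule.curry_apply, curry_apply, coe_restrictScalars,
      coe_comp, LinearEquiv.coe_coe, Function.comp_apply, assoc_tmul, lTensor_tmul,
      assoc_symm_tmul, rTensor_tmul, rid_tmul, map_smul, tmul_smul]
    induction Ψ (b ⊗ₜ[k] x) with
    | zero => simp
    | add u v hu hv => simp only [add_tmul, tmul_add, map_add, smul_add, hu, hv]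
    | tmul u v => simp [tensorCounit, smul_smul, mul_comm]
  have h := congrArg (· ∘ₗ map (cmul k C) (cmul k D)) middle
  refine Eq.trans ?_ (h.trans ?_)
  · rfl
  · simp only [comp_assoc, lTensor_comp_map, rid_comp_lTensor_eps_comp_cmul]
    rfl

/-- Extending `f : C ⊗ D → C` along `Δ_D` gives the identity exactly when `f = id_C ⊗ ε_D`. -/
theorem rTensor_comp_lTensor_cmul_eq_id_iff (f : C ⊗[k] D →ₗ[k] C) :
    rTensor D f ∘ₗ (TensorProduct.assoc k C D D).symm.toLinearMap ∘ₗ lTensor C (cmul k D)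
        = LinearMap.id
      ↔ f = piC := by
  constructor
  · intro h
    have project : piC ∘ₗ rTensor D f ∘ₗ (TensorProduct.assoc k C D D).symm.toLinearMap
        = f ∘ₗ lTensor C ((TensorProduct.rid k D).toLinearMap ∘ₗ lTensor D (eps k D)) := by
      ext c x y
      simp [piC]
    calc f = (piC ∘ₗ rTensor D f ∘ₗ (TensorProduct.assoc k C D D).symm.toLinearMap)
          ∘ₗ lTensor C (cmul k D) := by
          rw [project, comp_assoc, ← lTensor_comp, comp_assoc, rid_comp_lTensor_eps_comp_cmul,
            lTensor_id, comp_id]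
      _ = piC := by rw [comp_assoc, comp_assoc, h, comp_id]
  · rintro rfl
    have contract : rTensor D piC ∘ₗ (TensorProduct.assoc k C D D).symm.toLinearMap
        = lTensor C ((TensorProduct.lid k D).toLinearMap ∘ₗ rTensor D (eps k D)) := by
      ext c x y
      simp [piC, smul_tmul']
    rw [← comp_assoc, contract, ← lTensor_comp, comp_assoc, lid_comp_rTensor_eps_comp_cmul,
      lTensor_id]

/-- Extending `f : C ⊗ D → D` along `Δ_C` gives the identity exactly when `f = ε_C ⊗ id_D`. -/
theorem lTensor_comp_rTensor_cmul_eq_id_iff (f : C ⊗[k] D →ₗ[k] D) :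
    lTensor C f ∘ₗ (TensorProduct.assoc k C C D).toLinearMap ∘ₗ rTensor D (cmul k C)
        = LinearMap.id
      ↔ f = piD := by
  constructor
  · intro h
    have project : piD ∘ₗ lTensor C f ∘ₗ (TensorProduct.assoc k C C D).toLinearMap
        = f ∘ₗ rTensor D ((TensorProduct.lid k C).toLinearMap ∘ₗ rTensor C (eps k C)) := by
      ext a b d
      simp [piD, ← smul_tmul']
    calc f = (piD ∘ₗ lTensor C f ∘ₗ (TensorProduct.assoc k C C D).toLinearMap)
          ∘ₗ rTensor D (cmul k C) := by
          rw [project, comp_assoc, ← rTensor_comp, comp_assoc, lid_comp_rTensor_eps_comp_cmul,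
            rTensor_id, comp_id]
      _ = piD := by rw [comp_assoc, comp_assoc, h, comp_id]
  · rintro rfl
    have contract : lTensor C piD ∘ₗ (TensorProduct.assoc k C C D).toLinearMap
        = rTensor D ((TensorProduct.rid k C).toLinearMap ∘ₗ lTensor C (eps k C)) := by
      ext a b d
      simp [piD, smul_tmul']
    rw [← comp_assoc, contract, ← rTensor_comp, comp_assoc, rid_comp_lTensor_eps_comp_cmul,
      rTensor_id]

theorem stmt1 (Ψ : C ⊗[k] D →ₗ[k] D ⊗[k] C) :
    IsCounit (twistedComul Ψ) tensorCounit ↔ Conormal Ψ := by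
  rw [IsCounit, lid_comp_rTensor_tensorCounit_comp_twistedComul,
    rid_comp_lTensor_tensorCounit_comp_twistedComul, rTensor_comp_lTensor_cmul_eq_id_iff,
    lTensor_comp_rTensor_cmul_eq_id_iff]
  rfl

end TwistedTensor
end
end

section
/- Let Ψ : C⊗D → D⊗C be a conormal twist map. Then Ψ satisfies condition (CO) if and only if Ψ satisfies both pentagon conditions (CP1) and (CP2). -/
open TensorProduct LinearMap

noncomputable section
namespace TwistedTensor

variable {k : Type*} [Field k]
variable {C D : Type*} [AddCommGroup C] [Module k C] [AddCommGroup D] [Module k D]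
  [Coalgebra k C] [Coalgebra k D]

/-- The map `ε_C ⊗ id_V`. -/
def counitLeft (k C V : Type*) [Field k] [AddCommGroup C] [Module k C] [Coalgebra k C]
    [AddCommGroup V] [Module k V] : C ⊗[k] V →ₗ[k] V :=
  (TensorProduct.lid k V).toLinearMap ∘ₗ rTensor V (eps k C)

/-- The map `id_V ⊗ ε_D`. -/
def counitRight (k V D : Type*) [Field k] [AddCommGroup D] [Module k D] [Coalgebra k D]
    [AddCommGroup V] [Module k V] : V ⊗[k] D →ₗ[k] V :=
  (TensorProduct.rid k V).toLinearMap ∘ₗ lTensor V (eps k D)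

section Counit

variable {V W : Type*} [AddCommGroup V] [Module k V] [AddCommGroup W] [Module k W]

theorem counitLeft_tmul (c : C) (v : V) : counitLeft k C V (c ⊗ₜ[k] v) = eps k C c • v := by
  simp [counitLeft]

theorem counitRight_tmul (v : V) (d : D) : counitRight k V D (v ⊗ₜ[k] d) = eps k D d • v := by
  simp [counitRight]

theorem counitLeft_comp_lTensor (f : V →ₗ[k] W) :
    counitLeft k C W ∘ₗ lTensor C f = f ∘ₗ counitLeft k C V := by
  ext; simp [counitLeft_tmul]

theorem counitRight_comp_rTensor (f : V →ₗ[k] W) :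
    counitRight k W D ∘ₗ rTensor D f = f ∘ₗ counitRight k V D := by
  ext; simp [counitRight_tmul]

theorem counitLeft_comp_assoc_comp_comul :
    counitLeft k C (C ⊗[k] V) ∘ₗ (TensorProduct.assoc k C C V).toLinearMap
      ∘ₗ rTensor V (cmul k C) = LinearMap.id := by
  have h0 : counitLeft k C (C ⊗[k] V) ∘ₗ (TensorProduct.assoc k C C V).toLinearMap
      = rTensor V (counitLeft k C C) := by
    ext; simp [counitLeft_tmul, smul_tmul']
  have h1 : counitLeft k C C ∘ₗ cmul k C = LinearMap.id := by
    ext; simp [counitLeft, cmul, eps]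
  rw [← LinearMap.comp_assoc, h0, ← rTensor_comp, h1, rTensor_id]

theorem counitRight_comp_comul : counitRight k D D ∘ₗ cmul k D = LinearMap.id := by
  ext; simp [counitRight, cmul, eps]

theorem counitRight_comp_assoc_symm_comp_comul :
    counitRight k (V ⊗[k] D) D ∘ₗ (TensorProduct.assoc k V D D).symm.toLinearMap
      ∘ₗ lTensor V (cmul k D) = LinearMap.id := by
  have h0 : counitRight k (V ⊗[k] D) D ∘ₗ (TensorProduct.assoc k V D D).symm.toLinearMap
      = lTensor V (counitRight k D D) := by
    ext; simp [counitRight_tmul]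
  rw [← LinearMap.comp_assoc, h0, ← lTensor_comp, counitRight_comp_comul, lTensor_id]

end Counit

variable (Ψ : C ⊗[k] D →ₗ[k] D ⊗[k] C)

theorem lTensor_counitLeft_comp_COlhs :
    lTensor D (counitLeft k C (D ⊗[k] C)) ∘ₗ COlhs Ψ
      = lTensor D Ψ ∘ₗ (TensorProduct.assoc k D C D).toLinearMap ∘ₗ rTensor D Ψ
        ∘ₗ (TensorProduct.assoc k C D D).symm.toLinearMap ∘ₗ lTensor C (cmul k D) := by
  have key : counitLeft k C (D ⊗[k] C) ∘ₗ lTensor C Ψ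
      ∘ₗ (TensorProduct.assoc k C C D).toLinearMap ∘ₗ rTensor D (cmul k C) = Ψ := by
    rw [← LinearMap.comp_assoc, counitLeft_comp_lTensor, LinearMap.comp_assoc,
      counitLeft_comp_assoc_comp_comul, LinearMap.comp_id]
  calc _ = lTensor D (counitLeft k C (D ⊗[k] C) ∘ₗ lTensor C Ψ
            ∘ₗ (TensorProduct.assoc k C C D).toLinearMap ∘ₗ rTensor D (cmul k C))
          ∘ₗ (TensorProduct.assoc k D C D).toLinearMap ∘ₗ rTensor D Ψ
          ∘ₗ (TensorProduct.assoc k C D D).symm.toLinearMap ∘ₗ lTensor C (cmul k D) := by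
        simp only [COlhs, lTensor_comp, LinearMap.comp_assoc]
    _ = _ := by rw [key]

theorem lTensor_counitLeft_comp_COrhs (h : LeftConormal Ψ) :
    lTensor D (counitLeft k C (D ⊗[k] C)) ∘ₗ COrhs Ψ
      = (TensorProduct.assoc k D D C).toLinearMap ∘ₗ rTensor C (cmul k D) ∘ₗ Ψ := by
  have hΨ : counitRight k D C ∘ₗ Ψ = counitLeft k C D := h
  have h1 : lTensor D (counitLeft k C (D ⊗[k] C))
      ∘ₗ (TensorProduct.assoc k D C (D ⊗[k] C)).toLinearMap
      = rTensor (D ⊗[k] C) (counitRight k D C) := by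
    ext; simp [counitLeft_tmul, counitRight_tmul, smul_tmul]
  have h2 : rTensor (D ⊗[k] C) (counitLeft k C D)
      ∘ₗ (TensorProduct.assoc k C D (D ⊗[k] C)).symm.toLinearMap
      = counitLeft k C (D ⊗[k] (D ⊗[k] C)) := by
    ext; simp [counitLeft_tmul, smul_tmul']
  calc _ = (lTensor D (counitLeft k C (D ⊗[k] C))
            ∘ₗ (TensorProduct.assoc k D C (D ⊗[k] C)).toLinearMap)
          ∘ₗ rTensor (D ⊗[k] C) Ψ
          ∘ₗ (TensorProduct.assoc k C D (D ⊗[k] C)).symm.toLinearMap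
          ∘ₗ lTensor C ((TensorProduct.assoc k D D C).toLinearMap ∘ₗ rTensor C (cmul k D) ∘ₗ Ψ)
          ∘ₗ (TensorProduct.assoc k C C D).toLinearMap ∘ₗ rTensor D (cmul k C) := by
        simp only [COrhs, lTensor_comp, LinearMap.comp_assoc]
    _ = (rTensor (D ⊗[k] C) (counitRight k D C ∘ₗ Ψ)
            ∘ₗ (TensorProduct.assoc k C D (D ⊗[k] C)).symm.toLinearMap)
          ∘ₗ lTensor C ((TensorProduct.assoc k D D C).toLinearMap ∘ₗ rTensor C (cmul k D) ∘ₗ Ψ)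
          ∘ₗ (TensorProduct.assoc k C C D).toLinearMap ∘ₗ rTensor D (cmul k C) := by
        rw [h1]; simp only [rTensor_comp, LinearMap.comp_assoc]
    _ = _ := by
        rw [hΨ, h2, ← LinearMap.comp_assoc, counitLeft_comp_lTensor, LinearMap.comp_assoc,
          counitLeft_comp_assoc_comp_comul, LinearMap.comp_id]

/-- The map `id_D ⊗ id_C ⊗ ε_D ⊗ id_C`. -/
def counitThird (k C D : Type*) [Field k] [AddCommGroup C] [Module k C]
    [AddCommGroup D] [Module k D] [Coalgebra k D] :
    D ⊗[k] (C ⊗[k] (D ⊗[k] C)) →ₗ[k] D ⊗[k] (C ⊗[k] C) :=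
  lTensor D (lTensor C (counitLeft k D C))

theorem counitThird_comp_COlhs (h : RightConormal Ψ) :
    counitThird k C D ∘ₗ COlhs Ψ = lTensor D (cmul k C) ∘ₗ Ψ := by
  have hΨ : counitLeft k D C ∘ₗ Ψ = counitRight k C D := h
  have h1 : lTensor C (counitLeft k D C) ∘ₗ lTensor C Ψ
      ∘ₗ (TensorProduct.assoc k C C D).toLinearMap ∘ₗ rTensor D (cmul k C)
      = cmul k C ∘ₗ counitRight k C D := by
    have h0 : lTensor C (counitRight k C D) ∘ₗ (TensorProduct.assoc k C C D).toLinearMap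
        = counitRight k (C ⊗[k] C) D := by
      ext; simp [counitRight_tmul]
    rw [← LinearMap.comp_assoc, ← lTensor_comp, hΨ, ← LinearMap.comp_assoc, h0,
      counitRight_comp_rTensor]
  have h2 : lTensor D (counitRight k C D) ∘ₗ (TensorProduct.assoc k D C D).toLinearMap
      = counitRight k (D ⊗[k] C) D := by
    ext; simp [counitRight_tmul]
  calc _ = lTensor D (lTensor C (counitLeft k D C) ∘ₗ lTensor C Ψ
            ∘ₗ (TensorProduct.assoc k C C D).toLinearMap ∘ₗ rTensor D (cmul k C))
          ∘ₗ (TensorProduct.assoc k D C D).toLinearMap ∘ₗ rTensor D Ψ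
          ∘ₗ (TensorProduct.assoc k C D D).symm.toLinearMap ∘ₗ lTensor C (cmul k D) := by
        simp only [COlhs, counitThird, lTensor_comp, LinearMap.comp_assoc]
    _ = lTensor D (cmul k C) ∘ₗ ((lTensor D (counitRight k C D)
            ∘ₗ (TensorProduct.assoc k D C D).toLinearMap) ∘ₗ rTensor D Ψ)
          ∘ₗ (TensorProduct.assoc k C D D).symm.toLinearMap ∘ₗ lTensor C (cmul k D) := by
        rw [h1]; simp only [lTensor_comp, LinearMap.comp_assoc]
    _ = _ := by
        rw [h2, counitRight_comp_rTensor, LinearMap.comp_assoc,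
          counitRight_comp_assoc_symm_comp_comul, LinearMap.comp_id]

theorem counitThird_comp_COrhs :
    counitThird k C D ∘ₗ COrhs Ψ
      = (TensorProduct.assoc k D C C).toLinearMap ∘ₗ rTensor C Ψ
        ∘ₗ (TensorProduct.assoc k C D C).symm.toLinearMap ∘ₗ lTensor C Ψ
        ∘ₗ (TensorProduct.assoc k C C D).toLinearMap ∘ₗ rTensor D (cmul k C) := by
  have h1 : counitThird k C D ∘ₗ (TensorProduct.assoc k D C (D ⊗[k] C)).toLinearMap
        ∘ₗ rTensor (D ⊗[k] C) Ψ ∘ₗ (TensorProduct.assoc k C D (D ⊗[k] C)).symm.toLinearMap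
      = (TensorProduct.assoc k D C C).toLinearMap ∘ₗ rTensor C Ψ
        ∘ₗ (TensorProduct.assoc k C D C).symm.toLinearMap
        ∘ₗ lTensor C (lTensor D (counitLeft k D C)) := by
    ext c d d' c'
    simp only [counitThird, AlgebraTensorModule.curry_apply, curry_apply, restrictScalars_self,
      LinearMap.comp_apply, LinearEquiv.coe_coe, assoc_symm_tmul, rTensor_tmul, lTensor_tmul,
      counitLeft_tmul]
    induction Ψ (c ⊗ₜ[k] d) with
    | zero => simp
    | tmul a b => simp [counitLeft_tmul]
    | add a b ha hb => simp only [add_tmul, map_add, ha, hb]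
  have h2 : lTensor D (counitLeft k D C) ∘ₗ (TensorProduct.assoc k D D C).toLinearMap
      ∘ₗ rTensor C (cmul k D) = LinearMap.id := by
    have h0 : lTensor D (counitLeft k D C) ∘ₗ (TensorProduct.assoc k D D C).toLinearMap
        = rTensor C (counitRight k D D) := by
      ext; simp [counitLeft_tmul, counitRight_tmul, smul_tmul]
    rw [← LinearMap.comp_assoc, h0, ← rTensor_comp, counitRight_comp_comul, rTensor_id]
  calc _ = (counitThird k C D ∘ₗ (TensorProduct.assoc k D C (D ⊗[k] C)).toLinearMap
            ∘ₗ rTensor (D ⊗[k] C) Ψ ∘ₗ (TensorProduct.assoc k C D (D ⊗[k] C)).symm.toLinearMap)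
          ∘ₗ lTensor C (TensorProduct.assoc k D D C).toLinearMap
          ∘ₗ lTensor C (rTensor C (cmul k D)) ∘ₗ lTensor C Ψ
          ∘ₗ (TensorProduct.assoc k C C D).toLinearMap ∘ₗ rTensor D (cmul k C) := by
        simp only [COrhs, LinearMap.comp_assoc]
    _ = (TensorProduct.assoc k D C C).toLinearMap ∘ₗ rTensor C Ψ
        ∘ₗ (TensorProduct.assoc k C D C).symm.toLinearMap
        ∘ₗ lTensor C (lTensor D (counitLeft k D C) ∘ₗ (TensorProduct.assoc k D D C).toLinearMap
          ∘ₗ rTensor C (cmul k D)) ∘ₗ lTensor C Ψ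
        ∘ₗ (TensorProduct.assoc k C C D).toLinearMap ∘ₗ rTensor D (cmul k C) := by
        rw [h1]; simp only [lTensor_comp, LinearMap.comp_assoc]
    _ = _ := by rw [h2, lTensor_id, LinearMap.id_comp]

variable {Ψ}

theorem CondCO.of_CP (h₁ : CP1 Ψ) (h₂ : CP2 Ψ) : CondCO Ψ := by
  have hl : COlhs Ψ = lTensor D (lTensor C Ψ ∘ₗ (TensorProduct.assoc k C C D).toLinearMap)
      ∘ₗ (TensorProduct.assoc k D (C ⊗[k] C) D).toLinearMap
      ∘ₗ rTensor D (lTensor D (cmul k C) ∘ₗ Ψ)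
      ∘ₗ (TensorProduct.assoc k C D D).symm.toLinearMap ∘ₗ lTensor C (cmul k D) := by
    have h0 : lTensor D (rTensor D (cmul k C)) ∘ₗ (TensorProduct.assoc k D C D).toLinearMap
        = (TensorProduct.assoc k D (C ⊗[k] C) D).toLinearMap
          ∘ₗ rTensor D (lTensor D (cmul k C)) := by
      ext; simp
    calc _ = lTensor D (lTensor C Ψ ∘ₗ (TensorProduct.assoc k C C D).toLinearMap)
            ∘ₗ (lTensor D (rTensor D (cmul k C)) ∘ₗ (TensorProduct.assoc k D C D).toLinearMap)
            ∘ₗ rTensor D Ψ ∘ₗ (TensorProduct.assoc k C D D).symm.toLinearMap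
            ∘ₗ lTensor C (cmul k D) := rfl
      _ = _ := by rw [h0]; simp only [rTensor_comp, LinearMap.comp_assoc]
  have hr : COrhs Ψ = (TensorProduct.assoc k D C (D ⊗[k] C)).toLinearMap
      ∘ₗ rTensor (D ⊗[k] C) Ψ ∘ₗ (TensorProduct.assoc k C D (D ⊗[k] C)).symm.toLinearMap
      ∘ₗ lTensor C ((TensorProduct.assoc k D D C).toLinearMap ∘ₗ rTensor C (cmul k D) ∘ₗ Ψ)
      ∘ₗ (TensorProduct.assoc k C C D).toLinearMap ∘ₗ rTensor D (cmul k C) := by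
    simp only [COrhs, lTensor_comp, LinearMap.comp_assoc]
  rw [CondCO, hl, hr, ← h₁, ← h₂]
  ext c d
  simp only [AlgebraTensorModule.curry_apply, curry_apply, restrictScalars_self,
      LinearMap.comp_apply, LinearEquiv.coe_coe, rTensor_tmul, lTensor_tmul,
      rTensor_comp, lTensor_comp]
  have hC (y : D ⊗[k] D) : rTensor D (rTensor D (cmul k C))
      ((TensorProduct.assoc k C D D).symm (c ⊗ₜ[k] y))
        = (TensorProduct.assoc k (C ⊗[k] C) D D).symm (cmul k C c ⊗ₜ[k] y) := by
    induction y with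
    | zero => simp
    | tmul a b => simp
    | add a b ha hb => simp only [tmul_add, map_add, ha, hb]
  have hD (x : C ⊗[k] C) : lTensor C (lTensor C (cmul k D))
      ((TensorProduct.assoc k C C D) (x ⊗ₜ[k] d))
        = (TensorProduct.assoc k C C (D ⊗[k] D)) (x ⊗ₜ[k] cmul k D d) := by
    induction x with
    | zero => simp
    | tmul a b => simp
    | add a b ha hb => simp only [add_tmul, map_add, ha, hb]
  rw [hC, hD]
  generalize cmul k C c = x
  generalize cmul k D d = y
  induction x with
  | zero => simp
  | add a b ha hb => simp only [add_tmul, map_add, ha, hb]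
  | tmul c₁ c₂ =>
    induction y with
    | zero => simp
    | add a b ha hb => simp only [tmul_add, map_add, ha, hb]
    | tmul d₁ d₂ =>
      simp only [assoc_symm_tmul, assoc_tmul, rTensor_tmul, lTensor_tmul, LinearEquiv.coe_coe]
      induction Ψ (c₂ ⊗ₜ[k] d₁) with
      | zero => simp
      | add a b ha hb => simp only [tmul_add, add_tmul, map_add, ha, hb]
      | tmul d c =>
        simp only [assoc_symm_tmul, assoc_tmul, rTensor_tmul, lTensor_tmul]
        induction Ψ (c₁ ⊗ₜ[k] d) with
        | zero => simp
        | add a b ha hb => simp only [add_tmul, map_add, ha, hb]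
        | tmul d' c' => simp

theorem stmt2 (Ψ : C ⊗[k] D →ₗ[k] D ⊗[k] C) (h : Conormal Ψ) :
    CondCO Ψ ↔ (CP1 Ψ ∧ CP2 Ψ) := by
  refine ⟨fun hco => ⟨?_, ?_⟩, fun hcp => .of_CP hcp.1 hcp.2⟩
  · rw [CP1, ← lTensor_counitLeft_comp_COlhs, hco, lTensor_counitLeft_comp_COrhs Ψ h.2]
  · rw [CP2, ← counitThird_comp_COrhs, ← hco, counitThird_comp_COlhs Ψ h.1]

end TwistedTensor
end
end

section
/- Let C, D and Y be coassociative counital k-coalgebras. The following are equivalent: (1) there exists a conormal twist map Ψ : C⊗D → D⊗C satisfying condition (CO) together with a coalgebra isomorphism from Y to (C⊗D, Δ_Ψ, ε_C⊗ε_D); (2) Y factorizes through C and D, i.e. there exist coalgebra morphisms u_C : Y → C and u_D : Y → D such that the linear map (u_C ⊗ u_D) ∘ Δ_Y : Y → C⊗D is bijective. -/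
open TensorProduct LinearMap

noncomputable section
namespace TwistedTensor

variable {k : Type*} [Field k]
variable {C D : Type*} [AddCommGroup C] [Module k C] [AddCommGroup D] [Module k D]
  [Coalgebra k C] [Coalgebra k D]

section FromTwist

set_option linter.unusedSectionVars false

variable (Ψ : C ⊗[k] D →ₗ[k] D ⊗[k] C)

theorem piC_tmul (c : C) (d : D) : piC (k := k) (c ⊗ₜ d) = eps k D d • c := by
  simp [piC]

theorem piD_tmul (c : C) (d : D) : piD (k := k) (c ⊗ₜ d) = eps k C c • d := by
  simp [piD]

/-- The map `id_C ⊗ Ψ ⊗ id_D : (C⊗C)⊗(D⊗D) → (C⊗D)⊗(C⊗D)`. -/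
def twistMiddle : (C ⊗[k] C) ⊗[k] (D ⊗[k] D) →ₗ[k] (C ⊗[k] D) ⊗[k] (C ⊗[k] D) :=
  (TensorProduct.assoc k C D (C ⊗[k] D)).symm.toLinearMap
    ∘ₗ lTensor C (TensorProduct.assoc k D C D).toLinearMap
    ∘ₗ lTensor C (rTensor D Ψ)
    ∘ₗ lTensor C (TensorProduct.assoc k C D D).symm.toLinearMap
    ∘ₗ (TensorProduct.assoc k C C (D ⊗[k] D)).toLinearMap

theorem twistedComul_eq_twistMiddle_comp :
    twistedComul Ψ = twistMiddle Ψ ∘ₗ map (cmul k C) (cmul k D) := rfl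

theorem twistMiddle_tmul (c c' : C) (d d' : D) :
    twistMiddle Ψ ((c ⊗ₜ c') ⊗ₜ (d ⊗ₜ d')) =
      (TensorProduct.assoc k C D (C ⊗[k] D)).symm
        (c ⊗ₜ TensorProduct.assoc k D C D (Ψ (c' ⊗ₜ d) ⊗ₜ d')) := rfl

variable {Ψ}

theorem RightConormal.apply_tmul (h : RightConormal Ψ) (c : C) (d : D) :
    TensorProduct.lid k C (rTensor C (eps k D) (Ψ (c ⊗ₜ d))) = eps k D d • c := by
  simpa using LinearMap.congr_fun h (c ⊗ₜ d)

theorem LeftConormal.apply_tmul (h : LeftConormal Ψ) (c : C) (d : D) :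
    TensorProduct.rid k D (lTensor D (eps k C) (Ψ (c ⊗ₜ d))) = eps k C c • d := by
  simpa using LinearMap.congr_fun h (c ⊗ₜ d)

theorem RightConormal.map_piC_piC_twistMiddle (h : RightConormal Ψ) :
    map piC piC ∘ₗ twistMiddle Ψ = (TensorProduct.rid k (C ⊗[k] C)).toLinearMap
      ∘ₗ lTensor (C ⊗[k] C) ((TensorProduct.lid k k).toLinearMap ∘ₗ map (eps k D) (eps k D)) := by
  ext c c' d d'
  suffices H : ∀ t : D ⊗[k] C, map piC piC ((TensorProduct.assoc k C D (C ⊗[k] D)).symm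
      (c ⊗ₜ TensorProduct.assoc k D C D (t ⊗ₜ d'))) =
      c ⊗ₜ (eps k D d' • TensorProduct.lid k C (rTensor C (eps k D) t)) by
    simp [twistMiddle_tmul, H, h.apply_tmul, smul_smul, mul_comm]
  intro t
  induction t with
  | zero => simp
  | add x y hx hy => simp only [add_tmul, tmul_add, map_add, smul_add, hx, hy]
  | tmul x y => simp [piC_tmul, smul_tmul, smul_smul]

theorem LeftConormal.map_piD_piD_twistMiddle (h : LeftConormal Ψ) :
    map piD piD ∘ₗ twistMiddle Ψ = (TensorProduct.lid k (D ⊗[k] D)).toLinearMap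
      ∘ₗ rTensor (D ⊗[k] D) ((TensorProduct.lid k k).toLinearMap ∘ₗ map (eps k C) (eps k C)) := by
  ext c c' d d'
  suffices H : ∀ t : D ⊗[k] C, map piD piD ((TensorProduct.assoc k C D (C ⊗[k] D)).symm
      (c ⊗ₜ TensorProduct.assoc k D C D (t ⊗ₜ d'))) =
      (eps k C c • TensorProduct.rid k D (lTensor D (eps k C) t)) ⊗ₜ d' by
    simp [twistMiddle_tmul, H, h.apply_tmul, smul_smul, smul_tmul']
  intro t
  induction t with
  | zero => simp
  | add x y hx hy => simp only [add_tmul, tmul_add, map_add, smul_add, hx, hy]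
  | tmul x y => simp [piD_tmul, smul_tmul', smul_smul, mul_comm]

theorem RightConormal.map_piC_piD_twistMiddle (h : RightConormal Ψ) :
    map piC piD ∘ₗ twistMiddle Ψ =
      map ((TensorProduct.rid k C).toLinearMap ∘ₗ lTensor C (eps k C))
        ((TensorProduct.lid k D).toLinearMap ∘ₗ rTensor D (eps k D)) := by
  ext c c' d d'
  suffices H : ∀ t : D ⊗[k] C, map piC piD ((TensorProduct.assoc k C D (C ⊗[k] D)).symm
      (c ⊗ₜ TensorProduct.assoc k D C D (t ⊗ₜ d'))) =
      eps k C (TensorProduct.lid k C (rTensor C (eps k D) t)) • (c ⊗ₜ d') by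
    simp [twistMiddle_tmul, H, h.apply_tmul, smul_smul, smul_tmul', mul_comm]
  intro t
  induction t with
  | zero => simp
  | add x y hx hy => simp only [add_tmul, tmul_add, map_add, add_smul, hx, hy]
  | tmul x y => simp [piC_tmul, piD_tmul, smul_tmul', smul_smul, mul_comm]

theorem lid_rTensor_eps_cmul (E : Type*) [AddCommGroup E] [Module k E] [Coalgebra k E] :
    (TensorProduct.lid k E).toLinearMap ∘ₗ rTensor E (eps k E) ∘ₗ cmul k E = LinearMap.id := by
  ext x
  simp [eps, cmul]

theorem rid_lTensor_eps_cmul (E : Type*) [AddCommGroup E] [Module k E] [Coalgebra k E] :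
    (TensorProduct.rid k E).toLinearMap ∘ₗ lTensor E (eps k E) ∘ₗ cmul k E = LinearMap.id := by
  ext x
  simp [eps, cmul]

theorem lid_map_eps_eps_cmul (E : Type*) [AddCommGroup E] [Module k E] [Coalgebra k E] :
    (TensorProduct.lid k k).toLinearMap ∘ₗ map (eps k E) (eps k E) ∘ₗ cmul k E = eps k E := by
  ext x
  have h : map (eps k E) (eps k E) (cmul k E x) =
      lTensor k (eps k E) (rTensor E (eps k E) (cmul k E x)) := by
    rw [← lTensor_comp_rTensor, LinearMap.comp_apply]
  rw [LinearMap.comp_apply, LinearMap.comp_apply, h]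
  simp [eps, cmul]

theorem RightConormal.map_piC_piC_twistedComul (h : RightConormal Ψ) :
    map piC piC ∘ₗ twistedComul Ψ = cmul k C ∘ₗ piC := by
  rw [twistedComul_eq_twistMiddle_comp, ← LinearMap.comp_assoc, h.map_piC_piC_twistMiddle]
  ext c d
  have := LinearMap.congr_fun (lid_map_eps_eps_cmul (k := k) D) d
  simp only [LinearMap.comp_apply, LinearEquiv.coe_coe] at this
  simp [piC_tmul, this]

theorem LeftConormal.map_piD_piD_twistedComul (h : LeftConormal Ψ) :
    map piD piD ∘ₗ twistedComul Ψ = cmul k D ∘ₗ piD := by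
  rw [twistedComul_eq_twistMiddle_comp, ← LinearMap.comp_assoc, h.map_piD_piD_twistMiddle]
  ext c d
  have := LinearMap.congr_fun (lid_map_eps_eps_cmul (k := k) C) c
  simp only [LinearMap.comp_apply, LinearEquiv.coe_coe] at this
  simp [piD_tmul, this]

theorem RightConormal.map_piC_piD_twistedComul (h : RightConormal Ψ) :
    map piC piD ∘ₗ twistedComul Ψ = LinearMap.id := by
  rw [twistedComul_eq_twistMiddle_comp, ← LinearMap.comp_assoc, h.map_piC_piD_twistMiddle,
    ← map_comp, LinearMap.comp_assoc, LinearMap.comp_assoc, rid_lTensor_eps_cmul,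
    lid_rTensor_eps_cmul, map_id]

theorem eps_comp_piC : eps k C ∘ₗ piC = tensorCounit (k := k) (C := C) (D := D) := by
  ext c d
  simp [piC_tmul, tensorCounit, mul_comm]

theorem eps_comp_piD : eps k D ∘ₗ piD = tensorCounit (k := k) (C := C) (D := D) := by
  ext c d
  simp [piD_tmul, tensorCounit]

end FromTwist

section Convolution

variable {Y : Type*} [AddCommGroup Y] [Module k Y] [Coalgebra k Y]
variable {V W X : Type*} [AddCommGroup V] [Module k V] [AddCommGroup W] [Module k W]
  [AddCommGroup X] [Module k X]

/-- The convolution `y ↦ a(y₁) ⊗ b(y₂)` of two linear maps on a coalgebra. -/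
def tensorConv (a : Y →ₗ[k] V) (b : Y →ₗ[k] W) : Y →ₗ[k] V ⊗[k] W := map a b ∘ₗ cmul k Y

theorem map_comp_tensorConv {V' W' : Type*} [AddCommGroup V'] [Module k V'] [AddCommGroup W']
    [Module k W'] (g : V →ₗ[k] V') (g' : W →ₗ[k] W') (a : Y →ₗ[k] V) (b : Y →ₗ[k] W) :
    map g g' ∘ₗ tensorConv a b = tensorConv (g ∘ₗ a) (g' ∘ₗ b) := by
  rw [tensorConv, tensorConv, map_comp, LinearMap.comp_assoc]

theorem lTensor_comp_tensorConv (g : W →ₗ[k] X) (a : Y →ₗ[k] V) (b : Y →ₗ[k] W) :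
    lTensor V g ∘ₗ tensorConv a b = tensorConv a (g ∘ₗ b) :=
  map_comp_tensorConv LinearMap.id g a b

theorem rTensor_comp_tensorConv (g : V →ₗ[k] X) (a : Y →ₗ[k] V) (b : Y →ₗ[k] W) :
    rTensor W g ∘ₗ tensorConv a b = tensorConv (g ∘ₗ a) b :=
  map_comp_tensorConv g LinearMap.id a b

theorem assoc_comp_tensorConv (a : Y →ₗ[k] V) (b : Y →ₗ[k] W) (c : Y →ₗ[k] X) :
    (TensorProduct.assoc k V W X).toLinearMap ∘ₗ tensorConv (tensorConv a b) c =
      tensorConv a (tensorConv b c) := by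
  have h := congrArg (fun g => map a (map b c) ∘ₗ g) (Coalgebra.coassoc (R := k) (A := Y))
  have h₁ : map a (map b c) ∘ₗ (TensorProduct.assoc k Y Y Y).toLinearMap =
      (TensorProduct.assoc k V W X).toLinearMap ∘ₗ map (map a b) c := by
    ext; simp
  have h₂ : tensorConv (tensorConv a b) c =
      map (map a b) c ∘ₗ rTensor Y (cmul k Y) ∘ₗ cmul k Y := by
    rw [← LinearMap.comp_assoc, map_comp_rTensor]; rfl
  have h₃ : tensorConv a (tensorConv b c) =
      map a (map b c) ∘ₗ lTensor Y (cmul k Y) ∘ₗ cmul k Y := by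
    rw [← LinearMap.comp_assoc, map_comp_lTensor]; rfl
  rw [h₂, h₃, ← LinearMap.comp_assoc, ← h₁, LinearMap.comp_assoc]
  exact h

theorem assoc_symm_comp_tensorConv (a : Y →ₗ[k] V) (b : Y →ₗ[k] W) (c : Y →ₗ[k] X) :
    (TensorProduct.assoc k V W X).symm.toLinearMap ∘ₗ tensorConv a (tensorConv b c) =
      tensorConv (tensorConv a b) c := by
  rw [← assoc_comp_tensorConv, ← LinearMap.comp_assoc]
  ext; simp

theorem lid_rTensor_comp_tensorConv {a : Y →ₗ[k] V} (b : Y →ₗ[k] W) {e : V →ₗ[k] k}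
    (h : e ∘ₗ a = eps k Y) :
    (TensorProduct.lid k W).toLinearMap ∘ₗ rTensor W e ∘ₗ tensorConv a b = b := by
  have h₁ : (TensorProduct.lid k W).toLinearMap ∘ₗ map (eps k Y) b =
      b ∘ₗ (TensorProduct.lid k Y).toLinearMap ∘ₗ rTensor Y (eps k Y) := by
    ext; simp
  rw [rTensor_comp_tensorConv, h, tensorConv, ← LinearMap.comp_assoc, h₁, LinearMap.comp_assoc,
    LinearMap.comp_assoc, lid_rTensor_eps_cmul, LinearMap.comp_id]

theorem rid_lTensor_comp_tensorConv (a : Y →ₗ[k] V) {b : Y →ₗ[k] W} {e : W →ₗ[k] k}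
    (h : e ∘ₗ b = eps k Y) :
    (TensorProduct.rid k V).toLinearMap ∘ₗ lTensor V e ∘ₗ tensorConv a b = a := by
  have h₁ : (TensorProduct.rid k V).toLinearMap ∘ₗ map a (eps k Y) =
      a ∘ₗ (TensorProduct.rid k Y).toLinearMap ∘ₗ lTensor Y (eps k Y) := by
    ext; simp
  rw [lTensor_comp_tensorConv, h, tensorConv, ← LinearMap.comp_assoc, h₁, LinearMap.comp_assoc,
    LinearMap.comp_assoc, rid_lTensor_eps_cmul, LinearMap.comp_id]

end Convolution

section Factorization

variable {Y : Type*} [AddCommGroup Y] [Module k Y] [Coalgebra k Y]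
variable {uC : Y →ₗ[k] C} {uD : Y →ₗ[k] D} {Ψ : C ⊗[k] D →ₗ[k] D ⊗[k] C}

theorem twistedComul_comp_tensorConv (hC : cmul k C ∘ₗ uC = tensorConv uC uC)
    (hD : cmul k D ∘ₗ uD = tensorConv uD uD)
    (hΨ : Ψ ∘ₗ tensorConv uC uD = tensorConv uD uC) :
    twistedComul Ψ ∘ₗ tensorConv uC uD =
      tensorConv (tensorConv uC uD) (tensorConv uC uD) := by
  simp only [twistedComul, LinearMap.comp_assoc, map_comp_tensorConv, lTensor_comp_tensorConv,
    rTensor_comp_tensorConv, assoc_comp_tensorConv, assoc_symm_comp_tensorConv, hC, hD, hΨ]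

theorem condCO_of_comp_tensorConv (hC : cmul k C ∘ₗ uC = tensorConv uC uC)
    (hD : cmul k D ∘ₗ uD = tensorConv uD uD)
    (hΨ : Ψ ∘ₗ tensorConv uC uD = tensorConv uD uC)
    (hsurj : Function.Surjective (tensorConv uC uD)) : CondCO Ψ := by
  rw [CondCO, ← LinearMap.cancel_right hsurj]
  simp only [COlhs, COrhs, LinearMap.comp_assoc, lTensor_comp_tensorConv,
    rTensor_comp_tensorConv, assoc_comp_tensorConv, assoc_symm_comp_tensorConv, hC, hD, hΨ]

theorem conormal_of_comp_tensorConv (hC : eps k C ∘ₗ uC = eps k Y) (hD : eps k D ∘ₗ uD = eps k Y)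
    (hΨ : Ψ ∘ₗ tensorConv uC uD = tensorConv uD uC)
    (hsurj : Function.Surjective (tensorConv uC uD)) : Conormal Ψ := by
  constructor
  · rw [RightConormal, ← LinearMap.cancel_right hsurj]
    simp only [LinearMap.comp_assoc, hΨ, lid_rTensor_comp_tensorConv _ hD,
      rid_lTensor_comp_tensorConv _ hD]
  · rw [LeftConormal, ← LinearMap.cancel_right hsurj]
    simp only [LinearMap.comp_assoc, hΨ, lid_rTensor_comp_tensorConv _ hC,
      rid_lTensor_comp_tensorConv _ hC]

theorem tensorCounit_comp_tensorConv (hC : eps k C ∘ₗ uC = eps k Y)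
    (hD : eps k D ∘ₗ uD = eps k Y) : tensorCounit ∘ₗ tensorConv uC uD = eps k Y := by
  rw [← eps_comp_piC, piC, LinearMap.comp_assoc, LinearMap.comp_assoc,
    rid_lTensor_comp_tensorConv _ hD, hC]

end Factorization

theorem stmt3 {Y : Type*} [AddCommGroup Y] [Module k Y] [Coalgebra k Y] :
    (∃ Ψ : C ⊗[k] D →ₗ[k] D ⊗[k] C, Conormal Ψ ∧ CondCO Ψ ∧
      ∃ f : Y →ₗ[k] C ⊗[k] D, Function.Bijective f ∧
        map f f ∘ₗ cmul k Y = twistedComul Ψ ∘ₗ f ∧ tensorCounit ∘ₗ f = eps k Y)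
    ↔ (∃ (uC : Y →ₗ[k] C) (uD : Y →ₗ[k] D),
        (map uC uC ∘ₗ cmul k Y = cmul k C ∘ₗ uC ∧ eps k C ∘ₗ uC = eps k Y) ∧
        (map uD uD ∘ₗ cmul k Y = cmul k D ∘ₗ uD ∧ eps k D ∘ₗ uD = eps k Y) ∧
        Function.Bijective (map uC uD ∘ₗ cmul k Y)) := by
  constructor
  · rintro ⟨Ψ, ⟨hR, hL⟩, -, f, hf, hfΔ, hfε⟩
    refine ⟨piC ∘ₗ f, piD ∘ₗ f, ⟨?_, ?_⟩, ⟨?_, ?_⟩, ?_⟩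
    · rw [map_comp, LinearMap.comp_assoc, hfΔ, ← LinearMap.comp_assoc,
        hR.map_piC_piC_twistedComul, LinearMap.comp_assoc]
    · rw [← LinearMap.comp_assoc, eps_comp_piC, hfε]
    · rw [map_comp, LinearMap.comp_assoc, hfΔ, ← LinearMap.comp_assoc,
        hL.map_piD_piD_twistedComul, LinearMap.comp_assoc]
    · rw [← LinearMap.comp_assoc, eps_comp_piD, hfε]
    · rwa [map_comp, LinearMap.comp_assoc, hfΔ, ← LinearMap.comp_assoc,
        hR.map_piC_piD_twistedComul, LinearMap.id_comp]
  · rintro ⟨uC, uD, ⟨hC, hCε⟩, ⟨hD, hDε⟩, hbij⟩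
    change Function.Bijective (tensorConv uC uD) at hbij
    let e := LinearEquiv.ofBijective (tensorConv uC uD) hbij
    have hΨ : (tensorConv uD uC ∘ₗ e.symm.toLinearMap) ∘ₗ tensorConv uC uD =
        tensorConv uD uC := by
      ext y
      exact congrArg (tensorConv uD uC) (e.symm_apply_apply y)
    exact ⟨_, conormal_of_comp_tensorConv hCε hDε hΨ hbij.surjective,
      condCO_of_comp_tensorConv hC.symm hD.symm hΨ hbij.surjective, tensorConv uC uD, hbij,
      (twistedComul_comp_tensorConv hC.symm hD.symm hΨ).symm,
      tensorCounit_comp_tensorConv hCε hDε⟩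

end TwistedTensor
end
end

section
/- Let Ψ : C⊗D → D⊗C be a conormal twist map satisfying condition (CO). Let Y be a coassociative counital k-coalgebra and u_C : Y → C, u_D : Y → D coalgebra morphisms such that (u_D ⊗ u_C) ∘ Δ_Y = Ψ ∘ (u_C ⊗ u_D) ∘ Δ_Y. Then there exists a unique coalgebra morphism ω : Y → (C⊗D, Δ_Ψ, ε_C⊗ε_D) such that π_C ∘ ω = u_C and π_D ∘ ω = u_D, where π_C := id_C⊗ε_D : C⊗D → C and π_D := ε_C⊗id_D : C⊗D → D. -/
open TensorProduct LinearMap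

noncomputable section
namespace TwistedTensor

variable {k : Type*} [Field k]
variable {C D : Type*} [AddCommGroup C] [Module k C] [AddCommGroup D] [Module k D]
  [Coalgebra k C] [Coalgebra k D]

section CoalgebraIdentities

variable {Y : Type*} [AddCommGroup Y] [Module k Y] [Coalgebra k Y]

lemma assoc_rTensor_cmul_cmul (y : Y) :
    TensorProduct.assoc k Y Y Y (rTensor Y (cmul k Y) (cmul k Y y))
      = lTensor Y (cmul k Y) (cmul k Y y) :=
  Coalgebra.coassoc_apply y

lemma rTensor_eps_cmul (y : Y) : rTensor Y (eps k Y) (cmul k Y y) = 1 ⊗ₜ[k] y :=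
  Coalgebra.rTensor_counit_comul y

lemma lTensor_eps_cmul (y : Y) : lTensor Y (eps k Y) (cmul k Y y) = y ⊗ₜ[k] 1 :=
  Coalgebra.lTensor_counit_comul y

/-- Splitting both legs of `Δ` agrees with splitting the middle leg of the threefold coproduct. -/
lemma lTensor_assoc_symm_assoc_map_cmul_cmul (y : Y) :
    lTensor Y (TensorProduct.assoc k Y Y Y).symm.toLinearMap
        (TensorProduct.assoc k Y Y (Y ⊗[k] Y) (map (cmul k Y) (cmul k Y) (cmul k Y y)))
      = lTensor Y (rTensor Y (cmul k Y) ∘ₗ cmul k Y) (cmul k Y y) := by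
  have nat : ∀ t : (Y ⊗[k] Y) ⊗[k] Y,
      TensorProduct.assoc k Y Y (Y ⊗[k] Y) (lTensor (Y ⊗[k] Y) (cmul k Y) t)
        = lTensor Y (lTensor Y (cmul k Y)) (TensorProduct.assoc k Y Y Y t) := by
    intro t
    rw [← LinearEquiv.coe_toLinearMap, ← LinearEquiv.coe_toLinearMap, ← comp_apply, ← comp_apply]
    congr 1
    ext a b c
    simp
  rw [← lTensor_comp_rTensor, comp_apply, nat, assoc_rTensor_cmul_cmul, ← comp_apply,
    ← comp_apply, ← lTensor_comp, ← lTensor_comp]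
  congr 2
  ext z
  simp [← assoc_rTensor_cmul_cmul]

end CoalgebraIdentities

/-- The projections recover the identity from the twisted coproduct. -/
lemma map_piC_piD_comp_twistedComul (Ψ : C ⊗[k] D →ₗ[k] D ⊗[k] C) (hcon : Conormal Ψ) :
    map piC piD ∘ₗ twistedComul Ψ = LinearMap.id := by
  have hε : ((TensorProduct.lid k k).toLinearMap ∘ₗ map (eps k D) (eps k C)) ∘ₗ Ψ
      = (TensorProduct.lid k k).toLinearMap ∘ₗ map (eps k C) (eps k D) := by
    refine LinearMap.ext fun t => ?_
    have h := congrArg (eps k C) (LinearMap.congr_fun hcon.1 t)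
    have e₁ : eps k C ∘ₗ (TensorProduct.lid k C).toLinearMap ∘ₗ rTensor C (eps k D)
        = (TensorProduct.lid k k).toLinearMap ∘ₗ map (eps k D) (eps k C) := by
      ext a b; simp
    have e₂ : eps k C ∘ₗ (TensorProduct.rid k C).toLinearMap ∘ₗ lTensor C (eps k D)
        = (TensorProduct.lid k k).toLinearMap ∘ₗ map (eps k C) (eps k D) := by
      ext a b; simp [mul_comm]
    exact (LinearMap.congr_fun e₁ (Ψ t)).symm.trans (h.trans (LinearMap.congr_fun e₂ t))
  have outer : map piC piD ∘ₗ (TensorProduct.assoc k C D (C ⊗[k] D)).symm.toLinearMap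
        ∘ₗ lTensor C (TensorProduct.assoc k D C D).toLinearMap
      = lTensor C ((TensorProduct.lid k D).toLinearMap ∘ₗ
          rTensor D ((TensorProduct.lid k k).toLinearMap ∘ₗ map (eps k D) (eps k C))) := by
    ext a b c d
    simpa [piC, piD, TensorProduct.smul_tmul, mul_smul] using smul_comm _ _ _
  have inner : lTensor C ((TensorProduct.lid k D).toLinearMap ∘ₗ
          rTensor D ((TensorProduct.lid k k).toLinearMap ∘ₗ map (eps k C) (eps k D)))
        ∘ₗ lTensor C (TensorProduct.assoc k C D D).symm.toLinearMap
        ∘ₗ (TensorProduct.assoc k C C (D ⊗[k] D)).toLinearMap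
      = map ((TensorProduct.rid k C).toLinearMap ∘ₗ lTensor C (eps k C))
          ((TensorProduct.lid k D).toLinearMap ∘ₗ rTensor D (eps k D)) := by
    ext a b c d
    simpa [TensorProduct.smul_tmul, mul_smul] using smul_comm _ _ _
  have mid : lTensor C ((TensorProduct.lid k D).toLinearMap ∘ₗ
          rTensor D ((TensorProduct.lid k k).toLinearMap ∘ₗ map (eps k D) (eps k C)))
        ∘ₗ lTensor C (rTensor D Ψ)
      = lTensor C ((TensorProduct.lid k D).toLinearMap ∘ₗ
          rTensor D ((TensorProduct.lid k k).toLinearMap ∘ₗ map (eps k C) (eps k D))) := by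
    rw [← lTensor_comp, comp_assoc, ← rTensor_comp, hε]
  ext c d
  have h₁ := LinearMap.congr_fun outer
  have h₂ := LinearMap.congr_fun mid
  have h₃ := LinearMap.congr_fun inner
  simp only [comp_apply] at h₁ h₂ h₃
  simp only [twistedComul, AlgebraTensorModule.curry_apply, curry_apply, coe_restrictScalars,
    comp_apply, h₁, h₂, h₃, map_tmul, rTensor_eps_cmul, lTensor_eps_cmul, id_apply]
  simp

/-- The map induced by `uC` and `uD` is comultiplicative when they intertwine with `Ψ`. -/
lemma twistedComul_comp_map_comp_cmul {Y : Type*} [AddCommGroup Y] [Module k Y] [Coalgebra k Y]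
    (Ψ : C ⊗[k] D →ₗ[k] D ⊗[k] C) (uC : Y →ₗ[k] C) (uD : Y →ₗ[k] D)
    (huC : map uC uC ∘ₗ cmul k Y = cmul k C ∘ₗ uC)
    (huD : map uD uD ∘ₗ cmul k Y = cmul k D ∘ₗ uD)
    (hint : map uD uC ∘ₗ cmul k Y = Ψ ∘ₗ map uC uD ∘ₗ cmul k Y) :
    twistedComul Ψ ∘ₗ map uC uD ∘ₗ cmul k Y
      = map (map uC uD ∘ₗ cmul k Y) (map uC uD ∘ₗ cmul k Y) ∘ₗ cmul k Y := by
  have left : lTensor C (TensorProduct.assoc k C D D).symm.toLinearMap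
        ∘ₗ (TensorProduct.assoc k C C (D ⊗[k] D)).toLinearMap
        ∘ₗ map (map uC uC) (map uD uD)
      = map uC (map (map uC uD) uD) ∘ₗ lTensor Y (TensorProduct.assoc k Y Y Y).symm.toLinearMap
        ∘ₗ (TensorProduct.assoc k Y Y (Y ⊗[k] Y)).toLinearMap := by
    ext a b c d
    simp
  have right : map (map uC uD) (map uC uD)
      = (TensorProduct.assoc k C D (C ⊗[k] D)).symm.toLinearMap
        ∘ₗ lTensor C (TensorProduct.assoc k D C D).toLinearMap
        ∘ₗ map uC (map (map uD uC) uD)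
        ∘ₗ lTensor Y (TensorProduct.assoc k Y Y Y).symm.toLinearMap
        ∘ₗ (TensorProduct.assoc k Y Y (Y ⊗[k] Y)).toLinearMap := by
    ext a b c d
    simp
  have mid : lTensor C (rTensor D Ψ) ∘ₗ map uC (map (map uC uD) uD)
        ∘ₗ lTensor Y (rTensor Y (cmul k Y) ∘ₗ cmul k Y)
      = map uC (map (map uD uC) uD) ∘ₗ lTensor Y (rTensor Y (cmul k Y) ∘ₗ cmul k Y) := by
    simp only [lTensor, rTensor, ← map_comp, ← comp_assoc, id_comp, comp_id]
    rw [hint, comp_assoc]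
  ext y
  have h₁ := LinearMap.congr_fun left
  have h₂ := LinearMap.congr_fun mid
  have h₃ := LinearMap.congr_fun right
  have h₄ : map (cmul k C) (cmul k D) ∘ₗ map uC uD
      = map (map uC uC) (map uD uD) ∘ₗ map (cmul k Y) (cmul k Y) := by
    rw [← map_comp, ← map_comp, huC, huD]
  have h₄' := LinearMap.congr_fun h₄
  simp only [comp_apply, LinearEquiv.coe_toLinearMap] at h₁ h₂ h₃ h₄'
  simp only [twistedComul, map_comp, comp_apply, LinearEquiv.coe_toLinearMap, h₄', h₁, h₃,
    lTensor_assoc_symm_assoc_map_cmul_cmul, h₂]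

theorem stmt4 {Y : Type*} [AddCommGroup Y] [Module k Y] [Coalgebra k Y]
    (Ψ : C ⊗[k] D →ₗ[k] D ⊗[k] C) (hcon : Conormal Ψ) (hco : CondCO Ψ)
    (uC : Y →ₗ[k] C) (uD : Y →ₗ[k] D)
    (huC : map uC uC ∘ₗ cmul k Y = cmul k C ∘ₗ uC) (huC' : eps k C ∘ₗ uC = eps k Y)
    (huD : map uD uD ∘ₗ cmul k Y = cmul k D ∘ₗ uD) (huD' : eps k D ∘ₗ uD = eps k Y)
    (hint : map uD uC ∘ₗ cmul k Y = Ψ ∘ₗ map uC uD ∘ₗ cmul k Y) :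
    ∃! ω : Y →ₗ[k] C ⊗[k] D,
      (map ω ω ∘ₗ cmul k Y = twistedComul Ψ ∘ₗ ω ∧ tensorCounit ∘ₗ ω = eps k Y) ∧
      piC ∘ₗ ω = uC ∧ piD ∘ₗ ω = uD := by
  refine ⟨map uC uD ∘ₗ cmul k Y, ⟨⟨?_, ?_⟩, ?_, ?_⟩, ?_⟩
  · exact (twistedComul_comp_map_comp_cmul Ψ uC uD huC huD hint).symm
  · have h : map (eps k C) (eps k D) ∘ₗ map uC uD = lTensor k (eps k Y) ∘ₗ rTensor Y (eps k Y) := by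
      rw [← map_comp, huC', huD', lTensor_comp_rTensor]
    ext y
    have h' := LinearMap.congr_fun h (cmul k Y y)
    simp only [comp_apply, rTensor_eps_cmul] at h'
    simp [tensorCounit, h']
  · have h : lTensor C (eps k D) ∘ₗ map uC uD = rTensor k uC ∘ₗ lTensor Y (eps k Y) := by
      rw [lTensor_comp_map, huD', rTensor_comp_lTensor]
    ext y
    have h' := LinearMap.congr_fun h (cmul k Y y)
    simp only [comp_apply, lTensor_eps_cmul] at h'
    simp [piC, h']
  · have h : rTensor D (eps k C) ∘ₗ map uC uD = lTensor k uD ∘ₗ rTensor Y (eps k Y) := by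
      rw [rTensor_comp_map, huC', lTensor_comp_rTensor]
    ext y
    have h' := LinearMap.congr_fun h (cmul k Y y)
    simp only [comp_apply, rTensor_eps_cmul] at h'
    simp [piD, h']
  · rintro ω ⟨⟨hω, -⟩, rfl, rfl⟩
    rw [map_comp, comp_assoc, hω, ← comp_assoc, map_piC_piD_comp_twistedComul Ψ hcon, id_comp]

end TwistedTensor
end
end

section
/- Let Ψ : C⊗D → D⊗C be a twist map satisfying condition (CO) and let Z : C⊗D → D⊗C be a linear map. Then Ψ is Z-conormal if and only if the functional ε_Z := (ε_D⊗ε_C)∘Z : C⊗D → k is a counit for the twisted coproduct Δ_Ψ. -/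
open TensorProduct LinearMap

noncomputable section
namespace TwistedTensor

variable {k : Type*} [Field k]
variable {C D : Type*} [AddCommGroup C] [Module k C] [AddCommGroup D] [Module k D]
  [Coalgebra k C] [Coalgebra k D]

/-- The left-hand side `(e⊗id_C)∘(id_C⊗Ψ)∘(Δ_C⊗id_D)` of right conormality with respect to a
functional `e`. -/
def rightContract (Ψ : C ⊗[k] D →ₗ[k] D ⊗[k] C) (e : C ⊗[k] D →ₗ[k] k) : C ⊗[k] D →ₗ[k] C :=
  (TensorProduct.lid k C).toLinearMap ∘ₗ rTensor C e
      ∘ₗ (TensorProduct.assoc k C D C).symm.toLinearMap ∘ₗ lTensor C Ψ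
      ∘ₗ (TensorProduct.assoc k C C D).toLinearMap ∘ₗ rTensor D (cmul k C)

/-- The left-hand side `(id_D⊗e)∘(Ψ⊗id_D)∘(id_C⊗Δ_D)` of left conormality with respect to a
functional `e`. -/
def leftContract (Ψ : C ⊗[k] D →ₗ[k] D ⊗[k] C) (e : C ⊗[k] D →ₗ[k] k) : C ⊗[k] D →ₗ[k] D :=
  (TensorProduct.rid k D).toLinearMap ∘ₗ lTensor D e
      ∘ₗ (TensorProduct.assoc k D C D).toLinearMap ∘ₗ rTensor D Ψ
      ∘ₗ (TensorProduct.assoc k C D D).symm.toLinearMap ∘ₗ lTensor C (cmul k D)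

lemma lid_rTensor_twistedComul (Ψ : C ⊗[k] D →ₗ[k] D ⊗[k] C) (e : C ⊗[k] D →ₗ[k] k) :
    (TensorProduct.lid k (C ⊗[k] D)).toLinearMap ∘ₗ rTensor (C ⊗[k] D) e ∘ₗ twistedComul Ψ
      = rTensor D (rightContract Ψ e) ∘ₗ (TensorProduct.assoc k C D D).symm.toLinearMap
        ∘ₗ lTensor C (cmul k D) := by
  ext c d
  simp only [twistedComul, rightContract, AlgebraTensorModule.curry_apply, curry_apply,
    coe_restrictScalars, coe_comp, Function.comp_apply, LinearEquiv.coe_coe, map_tmul,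
    lTensor_tmul]
  generalize cmul k D d = y
  induction y with
  | zero => simp
  | add y₁ y₂ h₁ h₂ => simp only [tmul_add, map_add, h₁, h₂]
  | tmul d₁ d₂ =>
    simp only [assoc_symm_tmul, rTensor_tmul, coe_comp, Function.comp_apply, LinearEquiv.coe_coe]
    generalize cmul k C c = x
    induction x with
    | zero => simp
    | add x₁ x₂ h₁ h₂ => simp only [add_tmul, map_add, h₁, h₂]
    | tmul c₁ c₂ =>
      simp only [assoc_tmul, assoc_symm_tmul, rTensor_tmul, lTensor_tmul, LinearEquiv.coe_coe]
      generalize Ψ (c₂ ⊗ₜ d₁) = z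
      induction z with
      | zero => simp
      | add z₁ z₂ h₁ h₂ => simp only [tmul_add, add_tmul, map_add, h₁, h₂]
      | tmul d₃ c₃ => simp [smul_tmul']

lemma rid_lTensor_twistedComul (Ψ : C ⊗[k] D →ₗ[k] D ⊗[k] C) (e : C ⊗[k] D →ₗ[k] k) :
    (TensorProduct.rid k (C ⊗[k] D)).toLinearMap ∘ₗ lTensor (C ⊗[k] D) e ∘ₗ twistedComul Ψ
      = lTensor C (leftContract Ψ e) ∘ₗ (TensorProduct.assoc k C C D).toLinearMap
        ∘ₗ rTensor D (cmul k C) := by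
  ext c d
  simp only [twistedComul, leftContract, AlgebraTensorModule.curry_apply, curry_apply,
    coe_restrictScalars, coe_comp, Function.comp_apply, LinearEquiv.coe_coe, map_tmul,
    rTensor_tmul]
  generalize cmul k C c = x
  induction x with
  | zero => simp
  | add x₁ x₂ h₁ h₂ => simp only [add_tmul, map_add, h₁, h₂]
  | tmul c₁ c₂ =>
    simp only [assoc_tmul, lTensor_tmul, coe_comp, Function.comp_apply, LinearEquiv.coe_coe]
    generalize cmul k D d = y
    induction y with
    | zero => simp
    | add y₁ y₂ h₁ h₂ => simp only [tmul_add, map_add, h₁, h₂]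
    | tmul d₁ d₂ =>
      simp only [assoc_symm_tmul, rTensor_tmul]
      generalize Ψ (c₂ ⊗ₜ d₁) = z
      induction z with
      | zero => simp
      | add z₁ z₂ h₁ h₂ => simp only [tmul_add, add_tmul, map_add, h₁, h₂]
      | tmul d₃ c₃ => simp

/-- A linear map `R : C ⊗ D → C` extends to the identity as a map of right `D`-comodules
`C ⊗ D → C ⊗ D` exactly when `R = id_C ⊗ ε_D`. -/
lemma rTensor_comp_comul_eq_id_iff (R : C ⊗[k] D →ₗ[k] C) :
    rTensor D R ∘ₗ (TensorProduct.assoc k C D D).symm.toLinearMap ∘ₗ lTensor C (cmul k D)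
      = LinearMap.id ↔ R = (TensorProduct.rid k C).toLinearMap ∘ₗ lTensor C (eps k D) := by
  constructor
  · intro h
    rw [← LinearMap.comp_id ((TensorProduct.rid k C).toLinearMap ∘ₗ lTensor C (eps k D)), ← h]
    ext c d
    have key (y : D ⊗[k] D) : TensorProduct.rid k C (lTensor C (eps k D) (rTensor D R
        ((TensorProduct.assoc k C D D).symm (c ⊗ₜ y))))
          = R (c ⊗ₜ TensorProduct.rid k D (lTensor D (eps k D) y)) := by
      induction y with
      | zero => simp
      | add y₁ y₂ h₁ h₂ => simp only [tmul_add, map_add, h₁, h₂]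
      | tmul d₁ d₂ => simp
    simp only [AlgebraTensorModule.curry_apply, curry_apply, coe_restrictScalars, coe_comp,
      Function.comp_apply, LinearEquiv.coe_coe, lTensor_tmul, key]
    simp [cmul, eps]
  · rintro rfl
    ext c d
    have key (y : D ⊗[k] D) : rTensor D ((TensorProduct.rid k C).toLinearMap ∘ₗ
        lTensor C (eps k D)) ((TensorProduct.assoc k C D D).symm (c ⊗ₜ y))
          = c ⊗ₜ TensorProduct.lid k D (rTensor D (eps k D) y) := by
      induction y with
      | zero => simp
      | add y₁ y₂ h₁ h₂ => simp only [tmul_add, map_add, h₁, h₂]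
      | tmul d₁ d₂ => simp [smul_tmul]
    simp only [AlgebraTensorModule.curry_apply, curry_apply, coe_restrictScalars, coe_comp,
      Function.comp_apply, LinearEquiv.coe_coe, lTensor_tmul, key]
    simp [cmul, eps]

/-- A linear map `L : C ⊗ D → D` extends to the identity as a map of left `C`-comodules
`C ⊗ D → C ⊗ D` exactly when `L = ε_C ⊗ id_D`. -/
lemma lTensor_comp_comul_eq_id_iff (L : C ⊗[k] D →ₗ[k] D) :
    lTensor C L ∘ₗ (TensorProduct.assoc k C C D).toLinearMap ∘ₗ rTensor D (cmul k C)
      = LinearMap.id ↔ L = (TensorProduct.lid k D).toLinearMap ∘ₗ rTensor D (eps k C) := by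
  constructor
  · intro h
    rw [← LinearMap.comp_id ((TensorProduct.lid k D).toLinearMap ∘ₗ rTensor D (eps k C)), ← h]
    ext c d
    have key (x : C ⊗[k] C) : TensorProduct.lid k D (rTensor D (eps k C) (lTensor C L
        (TensorProduct.assoc k C C D (x ⊗ₜ d))))
          = L (TensorProduct.lid k C (rTensor C (eps k C) x) ⊗ₜ d) := by
      induction x with
      | zero => simp
      | add x₁ x₂ h₁ h₂ => simp only [add_tmul, map_add, h₁, h₂]
      | tmul c₁ c₂ => simp [← smul_tmul']
    simp only [AlgebraTensorModule.curry_apply, curry_apply, coe_restrictScalars, coe_comp,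
      Function.comp_apply, LinearEquiv.coe_coe, rTensor_tmul, key]
    simp [cmul, eps]
  · rintro rfl
    ext c d
    have key (x : C ⊗[k] C) : lTensor C ((TensorProduct.lid k D).toLinearMap ∘ₗ
        rTensor D (eps k C)) (TensorProduct.assoc k C C D (x ⊗ₜ d))
          = TensorProduct.rid k C (lTensor C (eps k C) x) ⊗ₜ d := by
      induction x with
      | zero => simp
      | add x₁ x₂ h₁ h₂ => simp only [add_tmul, map_add, h₁, h₂]
      | tmul c₁ c₂ => simp [smul_tmul]
    simp only [AlgebraTensorModule.curry_apply, curry_apply, coe_restrictScalars, coe_comp,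
      Function.comp_apply, LinearEquiv.coe_coe, rTensor_tmul, key]
    simp [cmul, eps]

theorem stmt6 (Ψ Z : C ⊗[k] D →ₗ[k] D ⊗[k] C) (hco : CondCO Ψ) :
    ZConormal Ψ Z ↔ IsCounit (twistedComul Ψ) (epsZ Z) := by
  rw [IsCounit, lid_rTensor_twistedComul, rid_lTensor_twistedComul,
    rTensor_comp_comul_eq_id_iff, lTensor_comp_comul_eq_id_iff]
  rfl

end TwistedTensor
end
end

section
/- Let Ψ : C⊗D → D⊗C be a twist map such that the twisted coproduct Δ_Ψ admits a counit e. Then the projection maps p_C := (id_C⊗e)∘(Δ_C⊗id_D) : C⊗D → C and p_D := (e⊗id_D)∘(id_C⊗Δ_D) : C⊗D → D are coalgebra morphisms from (C⊗D, Δ_Ψ, e) to (C, Δ_C, ε_C) and to (D, Δ_D, ε_D) respectively, i.e. (p_C⊗p_C)∘Δ_Ψ = Δ_C∘p_C, ε_C∘p_C = e, (p_D⊗p_D)∘Δ_Ψ = Δ_D∘p_D and ε_D∘p_D = e. -/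
open TensorProduct LinearMap

noncomputable section
namespace TwistedTensor

variable {k : Type*} [Field k]
variable {C D : Type*} [AddCommGroup C] [Module k C] [AddCommGroup D] [Module k D]
  [Coalgebra k C] [Coalgebra k D]

set_option linter.unusedSectionVars false

lemma rTensor_pC_assoc_symm (e : C ⊗[k] D →ₗ[k] k) (a : C) (w : D ⊗[k] (C ⊗[k] D)) :
    rTensor (C ⊗[k] D) (pC e) ((TensorProduct.assoc k C D (C ⊗[k] D)).symm (a ⊗ₜ w)) =
      lTensor C ((TensorProduct.lid k (C ⊗[k] D)).toLinearMap ∘ₗ rTensor (C ⊗[k] D) e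
        ∘ₗ (TensorProduct.assoc k C D (C ⊗[k] D)).symm.toLinearMap)
        (TensorProduct.assoc k C C (D ⊗[k] (C ⊗[k] D)) (cmul k C a ⊗ₜ w)) := by
  induction w with
  | zero => simp
  | add w w' hw hw' => simp only [tmul_add, map_add, hw, hw']
  | tmul d v =>
    simp only [pC, assoc_symm_tmul, rTensor_tmul, comp_apply, LinearEquiv.coe_coe]
    induction cmul k C a with
    | zero => simp
    | add z z' hz hz' => simp only [add_tmul, map_add, hz, hz']
    | tmul x y => simp [smul_tmul]

lemma lTensor_pD_assoc (e : C ⊗[k] D →ₗ[k] k) (w : (C ⊗[k] D) ⊗[k] C) (b : D) :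
    lTensor (C ⊗[k] D) (pD e) (TensorProduct.assoc k (C ⊗[k] D) C D (w ⊗ₜ b)) =
      rTensor D ((TensorProduct.rid k (C ⊗[k] D)).toLinearMap ∘ₗ lTensor (C ⊗[k] D) e
        ∘ₗ (TensorProduct.assoc k (C ⊗[k] D) C D).toLinearMap)
        ((TensorProduct.assoc k ((C ⊗[k] D) ⊗[k] C) D D).symm (w ⊗ₜ cmul k D b)) := by
  induction w with
  | zero => simp
  | add w w' hw hw' => simp only [add_tmul, map_add, hw, hw']
  | tmul v c =>
    simp only [pD, assoc_tmul, lTensor_tmul, comp_apply, LinearEquiv.coe_coe]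
    induction cmul k D b with
    | zero => simp
    | add z z' hz hz' => simp only [tmul_add, map_add, hz, hz']
    | tmul x y => simp [smul_tmul]

/-- `(p_C ⊗ id) ∘ Δ_Ψ = (id_C ⊗ (e ⊗ id) ∘ Δ_Ψ) ∘ (Δ_C ⊗ id_D)`. -/
lemma rTensor_pC_comp_twistedComul (Ψ : C ⊗[k] D →ₗ[k] D ⊗[k] C) (e : C ⊗[k] D →ₗ[k] k) :
    rTensor (C ⊗[k] D) (pC e) ∘ₗ twistedComul Ψ =
      lTensor C ((TensorProduct.lid k (C ⊗[k] D)).toLinearMap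
          ∘ₗ rTensor (C ⊗[k] D) e ∘ₗ twistedComul Ψ)
        ∘ₗ (TensorProduct.assoc k C C D).toLinearMap ∘ₗ rTensor D (cmul k C) := by
  ext c d
  let h : C →ₗ[k] D ⊗[k] (C ⊗[k] D) :=
    (TensorProduct.assoc k D C D).toLinearMap ∘ₗ rTensor D Ψ
      ∘ₗ (TensorProduct.assoc k C D D).symm.toLinearMap
      ∘ₗ (TensorProduct.mk k C (D ⊗[k] D)).flip (cmul k D d)
  let Φ : C ⊗[k] C →ₗ[k] (C ⊗[k] D) ⊗[k] (C ⊗[k] D) :=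
    (TensorProduct.assoc k C D (C ⊗[k] D)).symm.toLinearMap ∘ₗ lTensor C h
  let g : C ⊗[k] C →ₗ[k] C ⊗[k] D :=
    (TensorProduct.lid k (C ⊗[k] D)).toLinearMap ∘ₗ rTensor (C ⊗[k] D) e ∘ₗ Φ
  have hΦ (c : C) : twistedComul Ψ (c ⊗ₜ d) = Φ (cmul k C c) := by
    simp only [twistedComul, Φ, comp_apply, map_tmul, LinearEquiv.coe_coe]
    congr 1
    induction cmul k C c with
    | zero => simp
    | add z z' hz hz' => simp only [add_tmul, map_add, hz, hz']
    | tmul x y => simp [h]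
  have left (x : C ⊗[k] C) : rTensor (C ⊗[k] D) (pC e) (Φ x) =
      lTensor C g (TensorProduct.assoc k C C C (rTensor C (cmul k C) x)) := by
    induction x with
    | zero => simp
    | add x x' hx hx' => simp only [map_add, hx, hx']
    | tmul a b =>
      simp only [Φ, comp_apply, LinearEquiv.coe_coe, lTensor_tmul, rTensor_tmul]
      rw [rTensor_pC_assoc_symm]
      induction cmul k C a with
      | zero => simp
      | add z z' hz hz' => simp only [add_tmul, map_add, hz, hz']
      | tmul x y => simp [g, Φ]
  have right (x : C ⊗[k] C) : lTensor C ((TensorProduct.lid k (C ⊗[k] D)).toLinearMap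
          ∘ₗ rTensor (C ⊗[k] D) e ∘ₗ twistedComul Ψ) (TensorProduct.assoc k C C D (x ⊗ₜ d)) =
      lTensor C g (lTensor C (cmul k C) x) := by
    induction x with
    | zero => simp
    | add x x' hx hx' => simp only [map_add, hx, hx', add_tmul]
    | tmul a b => simp [g, hΦ]
  have coassoc : TensorProduct.assoc k C C C (rTensor C (cmul k C) (cmul k C c)) =
      lTensor C (cmul k C) (cmul k C c) := Coalgebra.coassoc_apply c
  simp only [AlgebraTensorModule.curry_apply, restrictScalars_self, curry_apply, comp_apply,
    LinearEquiv.coe_coe, rTensor_tmul]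
  rw [hΦ, left, coassoc]
  exact (right _).symm

/-- `(id ⊗ p_D) ∘ Δ_Ψ = ((id ⊗ e) ∘ Δ_Ψ ⊗ id_D) ∘ (id_C ⊗ Δ_D)`. -/
lemma lTensor_pD_comp_twistedComul (Ψ : C ⊗[k] D →ₗ[k] D ⊗[k] C) (e : C ⊗[k] D →ₗ[k] k) :
    lTensor (C ⊗[k] D) (pD e) ∘ₗ twistedComul Ψ =
      rTensor D ((TensorProduct.rid k (C ⊗[k] D)).toLinearMap
          ∘ₗ lTensor (C ⊗[k] D) e ∘ₗ twistedComul Ψ)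
        ∘ₗ (TensorProduct.assoc k C D D).symm.toLinearMap ∘ₗ lTensor C (cmul k D) := by
  ext c d
  let h : D →ₗ[k] (C ⊗[k] D) ⊗[k] C :=
    (TensorProduct.assoc k C D C).symm.toLinearMap ∘ₗ lTensor C Ψ
      ∘ₗ (TensorProduct.assoc k C C D).toLinearMap
      ∘ₗ TensorProduct.mk k (C ⊗[k] C) D (cmul k C c)
  let Φ : D ⊗[k] D →ₗ[k] (C ⊗[k] D) ⊗[k] (C ⊗[k] D) :=
    (TensorProduct.assoc k (C ⊗[k] D) C D).toLinearMap ∘ₗ rTensor D h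
  let g : D ⊗[k] D →ₗ[k] C ⊗[k] D :=
    (TensorProduct.rid k (C ⊗[k] D)).toLinearMap ∘ₗ lTensor (C ⊗[k] D) e ∘ₗ Φ
  have hΦ (d : D) : twistedComul Ψ (c ⊗ₜ d) = Φ (cmul k D d) := by
    simp only [twistedComul, Φ, comp_apply, map_tmul, LinearEquiv.coe_coe]
    induction cmul k D d with
    | zero => simp
    | add z z' hz hz' => simp only [tmul_add, map_add, hz, hz']
    | tmul x y =>
      simp only [h, rTensor_tmul, comp_apply, mk_apply, LinearEquiv.coe_coe]
      induction cmul k C c with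
      | zero => simp
      | add z z' hz hz' => simp only [add_tmul, map_add, hz, hz']
      | tmul a b =>
        simp only [LinearEquiv.coe_coe, assoc_tmul, assoc_symm_tmul, lTensor_tmul, rTensor_tmul]
        induction Ψ (b ⊗ₜ x) with
        | zero => simp
        | add z z' hz hz' => simp only [add_tmul, tmul_add, map_add, hz, hz']
        | tmul u v => simp
  have left (x : D ⊗[k] D) : lTensor (C ⊗[k] D) (pD e) (Φ x) =
      rTensor D g ((TensorProduct.assoc k D D D).symm (lTensor D (cmul k D) x)) := by
    induction x with
    | zero => simp
    | add x x' hx hx' => simp only [map_add, hx, hx']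
    | tmul a b =>
      simp only [Φ, comp_apply, LinearEquiv.coe_coe, lTensor_tmul, rTensor_tmul]
      rw [lTensor_pD_assoc]
      induction cmul k D b with
      | zero => simp
      | add z z' hz hz' => simp only [tmul_add, map_add, hz, hz']
      | tmul x y => simp [g, Φ]
  have right (x : D ⊗[k] D) : rTensor D ((TensorProduct.rid k (C ⊗[k] D)).toLinearMap
          ∘ₗ lTensor (C ⊗[k] D) e ∘ₗ twistedComul Ψ)
          ((TensorProduct.assoc k C D D).symm (c ⊗ₜ x)) =
      rTensor D g (rTensor D (cmul k D) x) := by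
    induction x with
    | zero => simp
    | add x x' hx hx' => simp only [map_add, hx, hx', tmul_add]
    | tmul a b => simp [g, hΦ]
  have coassoc : (TensorProduct.assoc k D D D).symm (lTensor D (cmul k D) (cmul k D d)) =
      rTensor D (cmul k D) (cmul k D d) := Coalgebra.coassoc_symm_apply d
  simp only [AlgebraTensorModule.curry_apply, restrictScalars_self, curry_apply, comp_apply,
    LinearEquiv.coe_coe, lTensor_tmul]
  rw [hΦ, left, coassoc]
  exact (right _).symm

/-- `p_C` is a morphism of left `C`-comodules. -/
lemma cmul_comp_pC (e : C ⊗[k] D →ₗ[k] k) :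
    cmul k C ∘ₗ pC e =
      lTensor C (pC e) ∘ₗ (TensorProduct.assoc k C C D).toLinearMap ∘ₗ rTensor D (cmul k C) := by
  ext c d
  let g : C ⊗[k] C →ₗ[k] C :=
    (TensorProduct.rid k C).toLinearMap ∘ₗ lTensor C (e ∘ₗ (TensorProduct.mk k C D).flip d)
  have hg (c : C) : pC e (c ⊗ₜ d) = g (cmul k C c) := by
    simp only [pC, g, comp_apply, rTensor_tmul, LinearEquiv.coe_coe]
    induction cmul k C c with
    | zero => simp
    | add z z' hz hz' => simp only [add_tmul, map_add, hz, hz']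
    | tmul x y => simp
  have left (x : C ⊗[k] C) : cmul k C (g x) =
      lTensor C g (TensorProduct.assoc k C C C (rTensor C (cmul k C) x)) := by
    induction x with
    | zero => simp
    | add x x' hx hx' => simp only [map_add, hx, hx']
    | tmul a b =>
      simp only [g, comp_apply, LinearEquiv.coe_coe, lTensor_tmul, rTensor_tmul, rid_tmul,
        map_smul]
      induction cmul k C a with
      | zero => simp
      | add z z' hz hz' => simp only [add_tmul, map_add, smul_add, hz, hz']
      | tmul x y => simp
  have right (x : C ⊗[k] C) : lTensor C (pC e) (TensorProduct.assoc k C C D (x ⊗ₜ d)) =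
      lTensor C g (lTensor C (cmul k C) x) := by
    induction x with
    | zero => simp
    | add x x' hx hx' => simp only [map_add, hx, hx', add_tmul]
    | tmul a b => simp [hg]
  have coassoc : TensorProduct.assoc k C C C (rTensor C (cmul k C) (cmul k C c)) =
      lTensor C (cmul k C) (cmul k C c) := Coalgebra.coassoc_apply c
  simp only [AlgebraTensorModule.curry_apply, restrictScalars_self, curry_apply, comp_apply,
    LinearEquiv.coe_coe, rTensor_tmul]
  rw [hg, left, coassoc]
  exact (right _).symm

/-- `p_D` is a morphism of right `D`-comodules. -/
lemma cmul_comp_pD (e : C ⊗[k] D →ₗ[k] k) :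
    cmul k D ∘ₗ pD e =
      rTensor D (pD e) ∘ₗ (TensorProduct.assoc k C D D).symm.toLinearMap
        ∘ₗ lTensor C (cmul k D) := by
  ext c d
  let g : D ⊗[k] D →ₗ[k] D :=
    (TensorProduct.lid k D).toLinearMap ∘ₗ rTensor D (e ∘ₗ TensorProduct.mk k C D c)
  have hg (d : D) : pD e (c ⊗ₜ d) = g (cmul k D d) := by
    simp only [pD, g, comp_apply, lTensor_tmul, LinearEquiv.coe_coe]
    induction cmul k D d with
    | zero => simp
    | add z z' hz hz' => simp only [tmul_add, map_add, hz, hz']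
    | tmul x y => simp
  have left (x : D ⊗[k] D) : cmul k D (g x) =
      rTensor D g ((TensorProduct.assoc k D D D).symm (lTensor D (cmul k D) x)) := by
    induction x with
    | zero => simp
    | add x x' hx hx' => simp only [map_add, hx, hx']
    | tmul a b =>
      simp only [g, comp_apply, LinearEquiv.coe_coe, lTensor_tmul, rTensor_tmul, lid_tmul,
        map_smul]
      induction cmul k D b with
      | zero => simp
      | add z z' hz hz' => simp only [tmul_add, map_add, smul_add, hz, hz']
      | tmul x y => simp [smul_tmul']
  have right (x : D ⊗[k] D) :
      rTensor D (pD e) ((TensorProduct.assoc k C D D).symm (c ⊗ₜ x)) =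
        rTensor D g (rTensor D (cmul k D) x) := by
    induction x with
    | zero => simp
    | add x x' hx hx' => simp only [map_add, hx, hx', tmul_add]
    | tmul a b => simp [hg]
  have coassoc : (TensorProduct.assoc k D D D).symm (lTensor D (cmul k D) (cmul k D d)) =
      rTensor D (cmul k D) (cmul k D d) := Coalgebra.coassoc_symm_apply d
  simp only [AlgebraTensorModule.curry_apply, restrictScalars_self, curry_apply, comp_apply,
    LinearEquiv.coe_coe, lTensor_tmul]
  rw [hg, left, coassoc]
  exact (right _).symm

lemma eps_comp_pC (e : C ⊗[k] D →ₗ[k] k) : eps k C ∘ₗ pC e = e := by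
  ext c d
  have counit : rTensor C (eps k C) (cmul k C c) = 1 ⊗ₜ c := Coalgebra.rTensor_counit_comul c
  have key (x : C ⊗[k] C) :
      eps k C (TensorProduct.rid k C (lTensor C e (TensorProduct.assoc k C C D (x ⊗ₜ d)))) =
        e (TensorProduct.lid k C (rTensor C (eps k C) x) ⊗ₜ d) := by
    induction x with
    | zero => simp
    | add x x' hx hx' => simp only [map_add, hx, hx', add_tmul]
    | tmul a b => simp [mul_comm, ← smul_tmul']
  simpa [pC, counit] using key (cmul k C c)

lemma eps_comp_pD (e : C ⊗[k] D →ₗ[k] k) : eps k D ∘ₗ pD e = e := by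
  ext c d
  have counit : lTensor D (eps k D) (cmul k D d) = d ⊗ₜ 1 := Coalgebra.lTensor_counit_comul d
  have key (x : D ⊗[k] D) :
      eps k D (TensorProduct.lid k D (rTensor D e ((TensorProduct.assoc k C D D).symm (c ⊗ₜ x)))) =
        e (c ⊗ₜ TensorProduct.rid k D (lTensor D (eps k D) x)) := by
    induction x with
    | zero => simp
    | add x x' hx hx' => simp only [map_add, hx, hx', tmul_add]
    | tmul a b => simp [mul_comm]
  simpa [pD, counit] using key (cmul k D d)

theorem stmt7 (Ψ : C ⊗[k] D →ₗ[k] D ⊗[k] C) (e : C ⊗[k] D →ₗ[k] k)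
    (he : IsCounit (twistedComul Ψ) e) :
    map (pC e) (pC e) ∘ₗ twistedComul Ψ = cmul k C ∘ₗ pC e ∧ eps k C ∘ₗ pC e = e ∧
    map (pD e) (pD e) ∘ₗ twistedComul Ψ = cmul k D ∘ₗ pD e ∧ eps k D ∘ₗ pD e = e := by
  refine ⟨?_, eps_comp_pC e, ?_, eps_comp_pD e⟩
  · rw [← lTensor_comp_rTensor, comp_assoc, rTensor_pC_comp_twistedComul, he.1, lTensor_id,
      id_comp, cmul_comp_pC]
  · rw [← rTensor_comp_lTensor, comp_assoc, lTensor_pD_comp_twistedComul, he.2, rTensor_id,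
      id_comp, cmul_comp_pD]

end TwistedTensor
end
end
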